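/- arXiv:1504.07618 — 6 statements merged into one kernel-verified Lean document; each statement's English description precedes it below -/
import Mathlib

section
/- For every positive integer n, the number of subgroups of the abelian group (ℤ/nℤ) × (ℤ/nℤ) equals α(n) := Σ_{a|n} Σ_{b|n} gcd(a,b), the sum of gcd(a,b) over all ordered pairs (a,b) of positive divisors of n. -/
/-- `α(n) = Σ_{a|n} Σ_{b|n} gcd(a,b)`, summed over ordered pairs of positive divisors of `n`. -/
def alphaFun (n : ℕ) : ℕ := ∑ a ∈ n.divisors, ∑ b ∈ n.divisors, Nat.gcd a b

/-- The subgroup of `ℤ × ℤ` generated by `(a, s)` and `(0, b)`. -/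
def hermiteSubgroup (a b s : ℤ) : AddSubgroup (ℤ × ℤ) where
  carrier := {p | ∃ k m : ℤ, p = (k * a, k * s + m * b)}
  zero_mem' := ⟨0, 0, by simp only [zero_mul, add_zero, Prod.zero_eq_mk]⟩
  add_mem' := by
    rintro _ _ ⟨k, m, rfl⟩ ⟨k', m', rfl⟩
    exact ⟨k + k', m + m', by ext <;> simp <;> ring⟩
  neg_mem' := by
    rintro _ ⟨k, m, rfl⟩
    exact ⟨-k, -m, by ext <;> (simp; try ring)⟩

theorem mem_hermiteSubgroup {a b s x y : ℤ} :
    (x, y) ∈ hermiteSubgroup a b s ↔ ∃ k m : ℤ, x = k * a ∧ y = k * s + m * b := by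
  change (∃ k m : ℤ, (x, y) = (k * a, k * s + m * b)) ↔ _
  simp only [Prod.mk.injEq]

theorem exists_mem_hermiteSubgroup_iff {a b s x : ℤ} :
    (∃ y, (x, y) ∈ hermiteSubgroup a b s) ↔ a ∣ x := by
  constructor
  · rintro ⟨y, h⟩
    obtain ⟨k, m, hx, -⟩ := mem_hermiteSubgroup.1 h
    exact ⟨k, by rw [hx, mul_comm]⟩
  · rintro ⟨k, rfl⟩
    exact ⟨k * s, mem_hermiteSubgroup.2 ⟨k, 0, by ring, by ring⟩⟩

theorem mul_mem_hermiteSubgroup_iff {a b s k y : ℤ} (ha : a ≠ 0) :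
    (k * a, y) ∈ hermiteSubgroup a b s ↔ b ∣ y - k * s := by
  rw [mem_hermiteSubgroup]
  constructor
  · rintro ⟨k', m, hk, hy⟩
    obtain rfl := mul_right_cancel₀ ha hk
    exact ⟨m, by rw [hy]; ring⟩
  · rintro ⟨m, hm⟩
    exact ⟨k, m, rfl, by linear_combination hm⟩

theorem hermiteSubgroup_injective {a b s a' b' s' : ℕ} (ha : a ≠ 0) (hs : s < b) (hs' : s' < b')
    (h : hermiteSubgroup a b s = hermiteSubgroup a' b' s') : a = a' ∧ b = b' ∧ s = s' := by
  have hdvd (x : ℤ) : (a : ℤ) ∣ x ↔ (a' : ℤ) ∣ x := by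
    rw [← exists_mem_hermiteSubgroup_iff (b := b) (s := s), h, exists_mem_hermiteSubgroup_iff]
  obtain rfl : a = a' := Nat.dvd_antisymm
    (Int.natCast_dvd_natCast.1 ((hdvd a').2 dvd_rfl))
    (Int.natCast_dvd_natCast.1 ((hdvd a).1 dvd_rfl))
  have ha0 : (a : ℤ) ≠ 0 := by exact_mod_cast ha
  have hiff (k y : ℤ) : (b : ℤ) ∣ y - k * s ↔ (b' : ℤ) ∣ y - k * s' := by
    rw [← mul_mem_hermiteSubgroup_iff ha0, h, mul_mem_hermiteSubgroup_iff ha0]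
  obtain rfl : b = b' := Nat.dvd_antisymm
    (Int.natCast_dvd_natCast.1 (by simpa using (hiff 0 b').2 (by simp)))
    (Int.natCast_dvd_natCast.1 (by simpa using (hiff 0 b).1 (by simp)))
  refine ⟨rfl, rfl, ?_⟩
  have hmod : s' ≡ s [MOD b] := (Nat.modEq_iff_dvd).2 (by simpa using (hiff 1 s).1 (by simp))
  exact (hmod.eq_of_lt_of_lt hs' hs).symm

theorem exists_natCast_dvd_iff_mem (K : AddSubgroup ℤ) : ∃ a : ℕ, ∀ x, x ∈ K ↔ (a : ℤ) ∣ x := by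
  obtain ⟨a, rfl⟩ := Int.subgroup_cyclic K
  exact ⟨a.natAbs, fun x => by
    rw [← AddSubgroup.zmultiples_eq_closure, Int.mem_zmultiples_iff, Int.natAbs_dvd]⟩

theorem exists_eq_hermiteSubgroup {K : AddSubgroup (ℤ × ℤ)} {y : ℤ} (hy : y ≠ 0)
    (hK : (0, y) ∈ K) : ∃ a b s : ℕ, s < b ∧ K = hermiteSubgroup a b s := by
  obtain ⟨a, ha⟩ := exists_natCast_dvd_iff_mem (K.map (AddMonoidHom.fst ℤ ℤ))
  obtain ⟨b, hb⟩ := exists_natCast_dvd_iff_mem (K.comap (AddMonoidHom.inr ℤ ℤ))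
  simp only [AddSubgroup.mem_map, AddMonoidHom.coe_fst, Prod.exists, exists_and_right,
    exists_eq_right] at ha
  simp only [AddSubgroup.mem_comap, AddMonoidHom.inr_apply] at hb
  have hb0 : 0 < b := by
    rcases Nat.eq_zero_or_pos b with rfl | h
    · exact absurd (by simpa using (hb y).1 hK) hy
    · exact h
  have hbz : (0 : ℤ) < b := by exact_mod_cast hb0
  obtain ⟨t, ht⟩ : ∃ t, ((a : ℤ), t) ∈ K := by simpa using (ha a).2 dvd_rfl
  obtain ⟨s, hs⟩ := Int.eq_ofNat_of_zero_le (Int.emod_nonneg t hbz.ne')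
  have hsb : (s : ℤ) < b := hs ▸ Int.emod_lt_of_pos t hbz
  have hsK : ((a : ℤ), (s : ℤ)) ∈ K := by
    have := K.sub_mem ht ((hb (b * (t / b))).2 (dvd_mul_right _ _))
    rw [Prod.mk_sub_mk, sub_zero, ← Int.emod_def, hs] at this
    exact this
  refine ⟨a, b, s, by exact_mod_cast hsb, ?_⟩
  ext ⟨x, z⟩
  rw [mem_hermiteSubgroup]
  have hmul (k : ℤ) : (k * (a : ℤ), k * (s : ℤ)) ∈ K := by
    simpa using K.zsmul_mem hsK k
  constructor
  · intro h
    obtain ⟨k, rfl⟩ := (ha x).1 (by simpa using ⟨z, h⟩)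
    rw [mul_comm (a : ℤ) k] at h
    have := K.sub_mem h (hmul k)
    rw [Prod.mk_sub_mk, sub_self] at this
    obtain ⟨m, hm⟩ := (hb _).1 this
    exact ⟨k, m, mul_comm _ _, by linear_combination hm⟩
  · rintro ⟨k, m, rfl, rfl⟩
    have := K.add_mem (hmul k) ((hb (m * b)).2 (dvd_mul_left _ _))
    rwa [Prod.mk_add_mk, add_zero] at this

theorem card_filter_range_dvd_mul {b : ℕ} (hb : 0 < b) (c : ℕ) :
    ((Finset.range b).filter (fun s => b ∣ c * s)).card = Nat.gcd c b := by
  obtain ⟨g, c', b', hg, hcop, hc, hb'⟩ := Nat.exists_coprime' (Nat.gcd_pos_of_pos_right c hb)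
  have hgcd : Nat.gcd c b = g := by
    rw [hc, hb', Nat.gcd_mul_right, Nat.Coprime.gcd_eq_one hcop, one_mul]
  rw [hgcd]
  have hb0 : 0 < b' := Nat.pos_of_ne_zero (by rintro rfl; simp at hb'; omega)
  have : (Finset.range b).filter (fun s => b ∣ c * s) = (Finset.range g).image (b' * ·) := by
    ext s
    have hdvd : b ∣ c * s ↔ b' ∣ s := by
      rw [hc, hb', mul_right_comm, Nat.mul_dvd_mul_iff_right hg]
      exact hcop.symm.dvd_mul_left
    simp only [Finset.mem_filter, Finset.mem_range, Finset.mem_image, hdvd]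
    constructor
    · rintro ⟨hs, t, rfl⟩
      exact ⟨t, Nat.lt_of_mul_lt_mul_left (hb' ▸ hs), rfl⟩
    · rintro ⟨t, ht, rfl⟩
      exact ⟨hb' ▸ Nat.mul_lt_mul_of_pos_left ht hb0, dvd_mul_right _ _⟩
  rw [this, Finset.card_image_of_injective _ (mul_right_injective₀ hb0.ne'), Finset.card_range]

/-- Subgroups of the codomain of a surjective homomorphism correspond to the subgroups of its
domain that contain its kernel. -/
theorem bijective_addSubgroup_comap {G H : Type*} [AddGroup G] [AddGroup H] {f : G →+ H}
    (hf : Function.Surjective f) : Function.Bijective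
      (fun K : AddSubgroup H => (⟨K.comap f, f.ker_le_comap K⟩ : {K // f.ker ≤ K})) := by
  constructor
  · intro K K' h
    exact AddSubgroup.comap_injective hf (congrArg Subtype.val h)
  · rintro ⟨K, hK⟩
    exact ⟨K.map f, Subtype.ext (AddSubgroup.comap_map_eq_self hK)⟩

theorem ker_prodMap_intCast_le_iff {n : ℕ} {K : AddSubgroup (ℤ × ℤ)} :
    ((Int.castAddHom (ZMod n)).prodMap (Int.castAddHom (ZMod n))).ker ≤ K ↔
      ((n : ℤ), (0 : ℤ)) ∈ K ∧ ((0 : ℤ), (n : ℤ)) ∈ K := by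
  constructor
  · exact fun h => ⟨h (by simp [AddMonoidHom.mem_ker]), h (by simp [AddMonoidHom.mem_ker])⟩
  · rintro ⟨h₁, h₂⟩ ⟨x, y⟩ h
    simp only [AddMonoidHom.mem_ker, AddMonoidHom.prodMap_def, AddMonoidHom.prod_apply,
      AddMonoidHom.comp_apply, AddMonoidHom.coe_fst, AddMonoidHom.coe_snd, Int.coe_castAddHom,
      Prod.mk_eq_zero, ZMod.intCast_zmod_eq_zero_iff_dvd] at h
    obtain ⟨⟨k, rfl⟩, ⟨m, rfl⟩⟩ := h
    simpa [mul_comm] using K.add_mem (K.zsmul_mem h₁ k) (K.zsmul_mem h₂ m)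

/-- Triples `((c, b), s)` parametrizing the subgroups of `ℤ × ℤ` containing `nℤ × nℤ`, where the
triple stands for the subgroup generated by `(n / c, s)` and `(0, b)`. -/
def hermiteTriples (n : ℕ) : Finset (Σ _ : ℕ × ℕ, ℕ) :=
  (n.divisors ×ˢ n.divisors).sigma fun p => (Finset.range p.2).filter fun s => p.2 ∣ p.1 * s

theorem card_hermiteTriples (n : ℕ) : (hermiteTriples n).card = alphaFun n := by
  rw [hermiteTriples, Finset.card_sigma, Finset.sum_product, alphaFun]
  exact Finset.sum_congr rfl fun c _ => Finset.sum_congr rfl fun b hb =>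
    card_filter_range_dvd_mul (Nat.pos_of_mem_divisors hb) c

theorem mem_hermiteTriples {n c b s : ℕ} (hn : n ≠ 0) :
    (⟨(c, b), s⟩ : Σ _ : ℕ × ℕ, ℕ) ∈ hermiteTriples n ↔
      c ∣ n ∧ b ∣ n ∧ s < b ∧ b ∣ c * s := by
  simp [hermiteTriples, hn, and_assoc]

theorem mem_hermiteSubgroup_and_iff {a b c s : ℕ} (ha : a ≠ 0) :
    (((c * a : ℕ) : ℤ), (0 : ℤ)) ∈ hermiteSubgroup a b s ∧
      ((0 : ℤ), ((c * a : ℕ) : ℤ)) ∈ hermiteSubgroup a b s ↔ b ∣ c * s ∧ b ∣ c * a := by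
  have ha0 : (a : ℤ) ≠ 0 := by exact_mod_cast ha
  have h := mul_mem_hermiteSubgroup_iff (b := b) (s := s) (k := 0) (y := (c * a : ℕ)) ha0
  rw [zero_mul, zero_mul, sub_zero, Int.natCast_dvd_natCast] at h
  rw [h, Nat.cast_mul, mul_mem_hermiteSubgroup_iff ha0, zero_sub, dvd_neg, ← Nat.cast_mul,
    Int.natCast_dvd_natCast]

theorem bijOn_hermiteSubgroup {n : ℕ} (hn : n ≠ 0) :
    Set.BijOn (fun t : Σ _ : ℕ × ℕ, ℕ => hermiteSubgroup (n / t.1.1 : ℕ) t.1.2 t.2)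
      (hermiteTriples n)
      {K | ((Int.castAddHom (ZMod n)).prodMap (Int.castAddHom (ZMod n))).ker ≤ K} := by
  refine ⟨?_, ?_, ?_⟩
  · rintro ⟨⟨c, b⟩, s⟩ ht
    obtain ⟨⟨a, rfl⟩, hb, -, hs⟩ := (mem_hermiteTriples hn).1 ht
    have hc : 0 < c := Nat.pos_of_ne_zero (left_ne_zero_of_mul hn)
    rw [Set.mem_ofPred_eq, ker_prodMap_intCast_le_iff]
    simp only [Nat.mul_div_cancel_left a hc]
    exact (mem_hermiteSubgroup_and_iff (right_ne_zero_of_mul hn)).2 ⟨hs, hb⟩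
  · rintro ⟨⟨c, b⟩, s⟩ ht ⟨⟨c', b'⟩, s'⟩ ht' h
    obtain ⟨hc, -, hs, -⟩ := (mem_hermiteTriples hn).1 ht
    obtain ⟨hc', -, hs', -⟩ := (mem_hermiteTriples hn).1 ht'
    obtain ⟨ha, rfl, rfl⟩ := hermiteSubgroup_injective
      (Nat.div_ne_zero_iff_of_dvd hc |>.2 ⟨hn, ne_zero_of_dvd_ne_zero hn hc⟩) hs hs' h
    obtain rfl : c = c' := by
      rw [← Nat.div_div_self hc hn, ha, Nat.div_div_self hc' hn]
    rfl
  · intro K hK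
    rw [Set.mem_ofPred_eq, ker_prodMap_intCast_le_iff] at hK
    obtain ⟨a, b, s, hs, rfl⟩ := exists_eq_hermiteSubgroup (by exact_mod_cast hn) hK.2
    obtain ⟨c, rfl⟩ : a ∣ n :=
      Int.natCast_dvd_natCast.1 (exists_mem_hermiteSubgroup_iff.1 ⟨0, hK.1⟩)
    rw [mul_comm] at hn hK
    have hc : 0 < c := Nat.pos_of_ne_zero (left_ne_zero_of_mul hn)
    obtain ⟨h₁, h₂⟩ := (mem_hermiteSubgroup_and_iff (right_ne_zero_of_mul hn)).1 hK
    rw [mul_comm a c]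
    exact ⟨⟨(c, b), s⟩, (mem_hermiteTriples hn).2 ⟨dvd_mul_right _ _, h₂, hs, h₁⟩,
      by simp only [Nat.mul_div_cancel_left a hc]⟩

/-- For every positive integer `n`, the number of subgroups of `(ℤ/nℤ) × (ℤ/nℤ)`
equals `α(n) = Σ_{a|n} Σ_{b|n} gcd(a,b)`. -/
theorem stmt1 (n : ℕ) (hn : 0 < n) :
    Nat.card (AddSubgroup (ZMod n × ZMod n)) = alphaFun n := by
  have hsurj : Function.Surjective
      ((Int.castAddHom (ZMod n)).prodMap (Int.castAddHom (ZMod n))) :=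
    Function.Surjective.prodMap ZMod.intCast_surjective ZMod.intCast_surjective
  rw [Nat.card_eq_of_bijective _ (bijective_addSubgroup_comap hsurj), ← card_hermiteTriples,
    ← Nat.card_eq_finsetCard]
  exact (Nat.card_congr ((bijOn_hermiteSubgroup hn.ne').equiv _)).symm
end

section
/- Let ℓ be an odd prime. The number of conjugacy classes of subgroups of GL₂(ℤ/ℓℤ) that are conjugate to a subgroup of the Borel group B(ℓ) and contain an element of order ℓ equals α(ℓ−1). -/
open Matrix Pointwise

/-- `GL₂(ℤ/ℓℤ)`. -/
abbrev GL2 (ℓ : ℕ) := GL (Fin 2) (ZMod ℓ)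

/-- The underlying matrix of an element of `GL₂(ℤ/ℓℤ)`. -/
def mat {ℓ : ℕ} (g : GL2 ℓ) : Matrix (Fin 2) (Fin 2) (ZMod ℓ) := g

/-- Membership in the Borel group `B(ℓ)` of upper triangular matrices. -/
def IsBorelElt {ℓ : ℕ} (g : GL2 ℓ) : Prop := mat g 1 0 = 0

/-- The number of conjugacy classes of subgroups satisfying `P`, i.e. the number of orbits
of the conjugation action on `{H : Subgroup G // P H}`. -/
noncomputable def conjClassCount {G : Type*} [Group G] (P : Subgroup G → Prop) : ℕ :=
  Nat.card (Quotient (Setoid.comap (Subtype.val : {H : Subgroup G // P H} → Subgroup G)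
    (MulAction.orbitRel (ConjAct G) (Subgroup G))))

/-- Homomorphisms out of a finite cyclic group are determined by an element killed by its order. -/
theorem IsCyclic.card_monoidHom {P Q : Type*} [Group P] [Finite P] [IsCyclic P]
    [CommGroup Q] [Finite Q] [IsCyclic Q] :
    Nat.card (P →* Q) = (Nat.card Q).gcd (Nat.card P) := by
  obtain ⟨g, hg⟩ := IsCyclic.exists_generator (α := P)
  have ho : orderOf g = Nat.card P := orderOf_eq_card_of_forall_mem_zpowers hg
  rw [← IsCyclic.card_powMonoidHom_ker Q (Nat.card P)]
  refine Nat.card_eq_of_bijective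
    (fun f : P →* Q => (⟨f g, ?_⟩ : (powMonoidHom (Nat.card P) : Q →* Q).ker)) ⟨?_, ?_⟩
  · rw [MonoidHom.mem_ker, powMonoidHom_apply, ← map_pow, pow_card_eq_one', map_one]
  · intro f₁ f₂ h
    exact (MonoidHom.eq_iff_eq_on_generator hg f₁ f₂).2 (congrArg Subtype.val h)
  · rintro ⟨q, hq⟩
    rw [MonoidHom.mem_ker, powMonoidHom_apply] at hq
    have hd : orderOf q ∣ orderOf g := ho ▸ orderOf_dvd_of_pow_eq_one hq
    exact ⟨monoidHomOfForallMemZpowers hg hd,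
      Subtype.ext (monoidHomOfForallMemZpowers_apply_gen hg hd)⟩

/-- A subgroup of a finite cyclic group is the kernel of raising to the power of its order. -/
theorem IsCyclic.eq_ker_powMonoidHom_card {A : Type*} [CommGroup A] [Finite A] [IsCyclic A]
    (H : Subgroup A) : H = (powMonoidHom (Nat.card H) : A →* A).ker := by
  refine Subgroup.eq_of_le_of_card_ge (fun x hx => ?_) ?_
  · rw [MonoidHom.mem_ker, powMonoidHom_apply]
    exact congrArg Subtype.val (pow_card_eq_one' (x := (⟨x, hx⟩ : H)))
  · rw [IsCyclic.card_powMonoidHom_ker, Nat.gcd_eq_right H.card_subgroup_dvd_card]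

theorem IsCyclic.sum_subgroup_card {A : Type*} [CommGroup A] [Finite A] [IsCyclic A]
    [Fintype (Subgroup A)] (f : ℕ → ℕ) :
    ∑ H : Subgroup A, f (Nat.card H) = ∑ d ∈ (Nat.card A).divisors, f d := by
  refine Finset.sum_bij (fun H _ => Nat.card H) (fun H _ => ?_) (fun H _ K _ h => ?_)
    (fun d hd => ⟨(powMonoidHom d : A →* A).ker, Finset.mem_univ _, ?_⟩) (fun _ _ => rfl)
  · exact Nat.mem_divisors.2 ⟨H.card_subgroup_dvd_card, Nat.card_pos.ne'⟩
  · rw [IsCyclic.eq_ker_powMonoidHom_card H, IsCyclic.eq_ker_powMonoidHom_card K, h]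
  · rw [IsCyclic.card_powMonoidHom_ker, Nat.gcd_eq_right (Nat.dvd_of_mem_divisors hd)]

/-- The subgroup of `A × A` with first projection `P` and second fibre `N` cut out by
a homomorphism `P →* A ⧸ N`. -/
def goursatSubgroup {A : Type*} [CommGroup A] (P N : Subgroup A) (φ : P →* A ⧸ N) :
    Subgroup (A × A) where
  carrier := {z | ∃ h : z.1 ∈ P, φ ⟨z.1, h⟩ = (z.2 : A ⧸ N)}
  one_mem' := ⟨P.one_mem, map_one φ⟩
  mul_mem' := by
    rintro x y ⟨hx, ex⟩ ⟨hy, ey⟩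
    refine ⟨P.mul_mem hx hy, ?_⟩
    rw [Prod.snd_mul, QuotientGroup.mk_mul, ← ex, ← ey, ← map_mul]
    rfl
  inv_mem' := by
    rintro x ⟨hx, ex⟩
    refine ⟨P.inv_mem hx, ?_⟩
    rw [Prod.snd_inv, QuotientGroup.mk_inv, ← ex, ← map_inv]
    rfl

theorem mem_goursatSubgroup {A : Type*} [CommGroup A] {P N : Subgroup A} {φ : P →* A ⧸ N}
    {z : A × A} :
    z ∈ goursatSubgroup P N φ ↔ ∃ h : z.1 ∈ P, φ ⟨z.1, h⟩ = (z.2 : A ⧸ N) := Iff.rfl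

theorem goursatSubgroup_bijective {A : Type*} [CommGroup A] :
    Function.Bijective (fun s : Σ P : Subgroup A, Σ N : Subgroup A, (P →* A ⧸ N) =>
      goursatSubgroup s.1 s.2.1 s.2.2) := by
  constructor
  · rintro ⟨P, N, φ⟩ ⟨P', N', φ'⟩ h
    dsimp only at h
    have hiff (x y : A) : (∃ h : x ∈ P, φ ⟨x, h⟩ = (y : A ⧸ N)) ↔
        ∃ h : x ∈ P', φ' ⟨x, h⟩ = (y : A ⧸ N') := SetLike.ext_iff.1 h (x, y)
    obtain rfl : P = P' := by
      ext x
      constructor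
      · intro hx
        obtain ⟨y, hy⟩ := QuotientGroup.mk_surjective (φ ⟨x, hx⟩)
        exact ((hiff x y).1 ⟨hx, hy.symm⟩).1
      · intro hx
        obtain ⟨y, hy⟩ := QuotientGroup.mk_surjective (φ' ⟨x, hx⟩)
        exact ((hiff x y).2 ⟨hx, hy.symm⟩).1
    obtain rfl : N = N' := by
      ext y
      have h1 : φ ⟨1, P.one_mem⟩ = 1 := map_one φ
      have h2 : φ' ⟨1, P.one_mem⟩ = 1 := map_one φ'
      have := hiff 1 y
      simpa [P.one_mem, h1, h2, eq_comm (a := (1 : A ⧸ N)), eq_comm (a := (1 : A ⧸ N')),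
        QuotientGroup.eq_one_iff] using this
    obtain rfl : φ = φ' := by
      ext ⟨x, hx⟩
      obtain ⟨y, hy⟩ := QuotientGroup.mk_surjective (φ ⟨x, hx⟩)
      rw [← hy, ((hiff x y).1 ⟨hx, hy.symm⟩).2]
    rfl
  · intro K
    have hex (x : K.map (MonoidHom.fst A A)) : ∃ y, (x.1, y) ∈ K := by
      obtain ⟨_, ⟨x, y⟩, h, rfl⟩ := x
      exact ⟨y, h⟩
    choose y hy using hex
    have key {x a b : A} (ha : (x, a) ∈ K) (hb : (x, b) ∈ K) :
        (a : A ⧸ K.comap (MonoidHom.inr A A)) = b := by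
      rw [QuotientGroup.eq, Subgroup.mem_comap]
      simpa using K.mul_mem (K.inv_mem ha) hb
    refine ⟨⟨K.map (MonoidHom.fst A A), K.comap (MonoidHom.inr A A),
      MonoidHom.mk' (fun x => (y x : A ⧸ K.comap (MonoidHom.inr A A))) fun a b =>
        key (hy (a * b)) (K.mul_mem (hy a) (hy b))⟩, ?_⟩
    ext ⟨a, b⟩
    rw [mem_goursatSubgroup]
    constructor
    · rintro ⟨h, e⟩
      have e' : (y ⟨a, h⟩)⁻¹ * b ∈ K.comap (MonoidHom.inr A A) := QuotientGroup.eq.1 e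
      simpa using K.mul_mem (hy ⟨a, h⟩) e'
    · intro h
      exact ⟨⟨(a, b), h, rfl⟩, key (hy _) h⟩

/-- The number of subgroups of `A × A`, for `A` finite cyclic. -/
theorem IsCyclic.card_subgroup_prod_self {A : Type*} [CommGroup A] [Finite A] [IsCyclic A] :
    Nat.card (Subgroup (A × A)) = alphaFun (Nat.card A) := by
  classical
  have := Fintype.ofFinite (Subgroup A)
  have (P N : Subgroup A) : Finite (P →* A ⧸ N) := Finite.of_injective _ DFunLike.coe_injective
  rw [← Nat.card_eq_of_bijective _ (goursatSubgroup_bijective (A := A)), Nat.card_sigma, alphaFun,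
    ← IsCyclic.sum_subgroup_card]
  refine Finset.sum_congr rfl fun P _ => ?_
  rw [Nat.card_sigma, ← Nat.sum_div_divisors, ← IsCyclic.sum_subgroup_card]
  refine Finset.sum_congr rfl fun N _ => ?_
  rw [IsCyclic.card_monoidHom, Nat.gcd_comm, ← Subgroup.index_eq_card,
    ← N.card_mul_index, Nat.mul_div_cancel_left _ Nat.card_pos]

section Borel

variable {ℓ : ℕ}

theorem mat_mul (g h : GL2 ℓ) : mat (g * h) = mat g * mat h := rfl

theorem mat_one : mat (1 : GL2 ℓ) = 1 := rfl

theorem mat_mul_apply (g h : GL2 ℓ) (i j : Fin 2) :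
    mat (g * h) i j = mat g i 0 * mat h 0 j + mat g i 1 * mat h 1 j := by
  rw [mat_mul, Matrix.mul_apply, Fin.sum_univ_two]

theorem GL2_ext {g h : GL2 ℓ} (h00 : mat g 0 0 = mat h 0 0) (h01 : mat g 0 1 = mat h 0 1)
    (h10 : mat g 1 0 = mat h 1 0) (h11 : mat g 1 1 = mat h 1 1) : g = h := by
  refine Units.ext (Matrix.ext fun i j => ?_)
  fin_cases i <;> fin_cases j <;> assumption

theorem det_mat_ne_zero [Fact ℓ.Prime] (g : GL2 ℓ) :
    mat g 0 0 * mat g 1 1 - mat g 0 1 * mat g 1 0 ≠ 0 := by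
  rw [← Matrix.det_fin_two]
  exact g.det.ne_zero

theorem IsBorelElt.inv [Fact ℓ.Prime] {g : GL2 ℓ} (hg : IsBorelElt g) : IsBorelElt g⁻¹ := by
  have h := mat_mul_apply g⁻¹ g 1 0
  have hd := det_mat_ne_zero g
  rw [IsBorelElt] at hg
  rw [inv_mul_cancel, mat_one, hg] at h
  rw [hg, mul_zero, sub_zero] at hd
  rw [IsBorelElt]
  simpa [left_ne_zero_of_mul hd] using h

/-- The Borel subgroup of upper triangular matrices. -/
def borelGroup (ℓ : ℕ) [Fact ℓ.Prime] : Subgroup (GL2 ℓ) where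
  carrier := {g | IsBorelElt g}
  one_mem' := by simp [IsBorelElt, mat_one]
  mul_mem' {g h} hg hh := by
    simp only [Set.mem_ofPred_eq, IsBorelElt] at *
    simp [mat_mul_apply, hg, hh]
  inv_mem' hg := IsBorelElt.inv hg

variable [Fact ℓ.Prime]

theorem mem_borelGroup {g : GL2 ℓ} : g ∈ borelGroup ℓ ↔ mat g 1 0 = 0 := Iff.rfl

/-- The diagonal of an upper triangular matrix. -/
def borelDiag (ℓ : ℕ) [Fact ℓ.Prime] : borelGroup ℓ →* (ZMod ℓ)ˣ × (ZMod ℓ)ˣ :=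
  MonoidHom.prod
    (MonoidHom.toHomUnits
      { toFun := fun g => mat g.1 0 0
        map_one' := by simp [mat_one]
        map_mul' := fun g h => by
          have := mem_borelGroup.1 h.2
          simp [mat_mul_apply, this] })
    (MonoidHom.toHomUnits
      { toFun := fun g => mat g.1 1 1
        map_one' := by simp [mat_one]
        map_mul' := fun g h => by
          have := mem_borelGroup.1 g.2
          simp [mat_mul_apply, this] })

theorem borelDiag_fst (g : borelGroup ℓ) : ((borelDiag ℓ g).1 : ZMod ℓ) = mat g.1 0 0 := rfl

theorem borelDiag_snd (g : borelGroup ℓ) : ((borelDiag ℓ g).2 : ZMod ℓ) = mat g.1 1 1 := rfl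

theorem borelDiag_surjective : Function.Surjective (borelDiag ℓ) := by
  rintro ⟨a, d⟩
  have hdet : (!![(a : ZMod ℓ), 0; 0, (d : ZMod ℓ)]).det ≠ 0 := by
    simp [Matrix.det_fin_two]
  refine ⟨⟨GeneralLinearGroup.mkOfDetNeZero _ hdet, ?_⟩, ?_⟩
  · rw [mem_borelGroup]; simp [mat, GeneralLinearGroup.mkOfDetNeZero]
  · refine Prod.ext (Units.ext ?_) (Units.ext ?_)
    · simp [borelDiag_fst, mat, GeneralLinearGroup.mkOfDetNeZero]
    · simp [borelDiag_snd, mat, GeneralLinearGroup.mkOfDetNeZero]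

/-- The upper triangular matrices whose diagonal lies in `K`. -/
def borelSubgroup (K : Subgroup ((ZMod ℓ)ˣ × (ZMod ℓ)ˣ)) : Subgroup (GL2 ℓ) :=
  (K.comap (borelDiag ℓ)).map (borelGroup ℓ).subtype

theorem mem_borelSubgroup {K : Subgroup ((ZMod ℓ)ˣ × (ZMod ℓ)ˣ)} {g : GL2 ℓ} :
    g ∈ borelSubgroup K ↔ ∃ h : g ∈ borelGroup ℓ, borelDiag ℓ ⟨g, h⟩ ∈ K := by
  constructor
  · rintro ⟨x, hx, rfl⟩
    exact ⟨x.2, hx⟩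
  · rintro ⟨h, hK⟩
    exact ⟨⟨g, h⟩, hK, rfl⟩

/-- The upper unitriangular matrix with corner entry `b`. -/
def unip (b : ZMod ℓ) : GL2 ℓ :=
  GeneralLinearGroup.mkOfDetNeZero !![1, b; 0, 1] (by simp [Matrix.det_fin_two])

theorem mat_unip (b : ZMod ℓ) : mat (unip b) = !![1, b; 0, 1] := rfl

theorem unip_pow (b : ZMod ℓ) (n : ℕ) : unip b ^ n = unip ((n : ZMod ℓ) * b) := by
  induction n with
  | zero => refine GL2_ext ?_ ?_ ?_ ?_ <;> simp [mat_unip, mat_one]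
  | succ n ih =>
    rw [pow_succ, ih]
    refine GL2_ext ?_ ?_ ?_ ?_ <;> simp [mat_unip, mat_mul_apply]
    ring

theorem unip_zero : unip (0 : ZMod ℓ) = 1 := by
  rw [← pow_zero (unip (0 : ZMod ℓ)), unip_pow, mul_zero]

theorem unip_one_ne_one : unip (1 : ZMod ℓ) ≠ 1 := fun h => by
  simpa [mat_unip, mat_one] using congrArg (fun g => mat g 0 1) h

theorem orderOf_unip_one : orderOf (unip (1 : ZMod ℓ)) = ℓ :=
  orderOf_eq_prime (by rw [unip_pow, CharP.cast_eq_zero, zero_mul, unip_zero]) unip_one_ne_one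

theorem unip_mem_borelGroup (b : ZMod ℓ) : unip b ∈ borelGroup ℓ := by
  simp [mem_borelGroup, mat_unip]

theorem borelDiag_unip (b : ZMod ℓ) : borelDiag ℓ ⟨unip b, unip_mem_borelGroup b⟩ = 1 :=
  Prod.ext (Units.ext (by simp [borelDiag_fst, mat_unip]))
    (Units.ext (by simp [borelDiag_snd, mat_unip]))

theorem unip_mem_borelSubgroup (K : Subgroup ((ZMod ℓ)ˣ × (ZMod ℓ)ˣ)) (b : ZMod ℓ) :
    unip b ∈ borelSubgroup K :=
  mem_borelSubgroup.2 ⟨unip_mem_borelGroup b, by rw [borelDiag_unip]; exact K.one_mem⟩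

theorem eq_unip_of_borelDiag_eq_one {g : borelGroup ℓ} (hg : borelDiag ℓ g = 1) :
    g.1 = unip (mat g.1 0 1) := by
  have h0 := borelDiag_fst g
  have h1 := borelDiag_snd g
  have h2 := mem_borelGroup.1 g.2
  rw [hg] at h0 h1
  refine GL2_ext ?_ ?_ ?_ ?_ <;> simp_all [mat_unip]

/-- An upper triangular matrix of order `ℓ` is unitriangular, and generates all such matrices. -/
theorem unip_mem_of_orderOf_eq {H : Subgroup (GL2 ℓ)} {x : GL2 ℓ} (hx : x ∈ H)
    (hB : x ∈ borelGroup ℓ) (ho : orderOf x = ℓ) (b : ZMod ℓ) : unip b ∈ H := by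
  have hpow : (⟨x, hB⟩ : borelGroup ℓ) ^ ℓ = 1 :=
    Subtype.ext (orderOf_dvd_iff_pow_eq_one.1 ho.dvd)
  have hd : borelDiag ℓ ⟨x, hB⟩ = 1 := by
    have h := congrArg (borelDiag ℓ) hpow
    rw [map_pow, map_one] at h
    refine Prod.ext (Units.ext ?_) (Units.ext ?_)
    · have h' := congrArg (fun z => (z.1 : ZMod ℓ)) h
      simpa [ZMod.pow_card] using h'
    · have h' := congrArg (fun z => (z.2 : ZMod ℓ)) h
      simpa [ZMod.pow_card] using h'
  have hx' : x = unip (mat x 0 1) := eq_unip_of_borelDiag_eq_one hd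
  have hne : mat x 0 1 ≠ 0 := by
    intro h0
    rw [h0, unip_zero] at hx'
    rw [hx', orderOf_one] at ho
    exact (Fact.out : ℓ.Prime).one_lt.ne ho
  have h := H.pow_mem hx (b / mat x 0 1).val
  rw [hx', unip_pow, ZMod.natCast_zmod_val] at h
  simpa [mat_unip, div_mul_cancel₀ _ hne] using h

theorem mem_borelGroup_of_conj_unip {c : GL2 ℓ} (h : c * unip 1 * c⁻¹ ∈ borelGroup ℓ) : c ∈ borelGroup ℓ := by
  set m := c * unip 1 * c⁻¹ with hm
  have e : m * c = c * unip 1 := by rw [hm, inv_mul_cancel_right]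
  have e0 := congrArg (fun g => mat g 1 0) e
  have e1 := congrArg (fun g => mat g 1 1) e
  rw [mem_borelGroup] at h ⊢
  simp only [mat_mul_apply, mat_unip, h] at e0 e1
  simp only [Fin.isValue, zero_mul, zero_add, of_apply, cons_val', cons_val_zero,
    cons_val_fin_one, mul_one, cons_val_one, mul_zero, add_zero] at e0 e1
  by_contra hc
  have e2 : mat m 1 1 = 1 := mul_right_cancel₀ hc (by rw [e0, one_mul])
  rw [e2] at e1
  apply hc
  linear_combination -e1

theorem borelDiag_conj (c g : borelGroup ℓ) : borelDiag ℓ (c * g * c⁻¹) = borelDiag ℓ g := by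
  rw [map_mul, map_mul, map_inv, mul_comm (borelDiag ℓ c), mul_inv_cancel_right]

theorem le_of_conj_borelSubgroup {K K' : Subgroup ((ZMod ℓ)ˣ × (ZMod ℓ)ˣ)} {c : GL2 ℓ}
    (h : ∀ g ∈ borelSubgroup K, c * g * c⁻¹ ∈ borelSubgroup K') : K ≤ K' := by
  intro k hk
  obtain ⟨g, rfl⟩ := borelDiag_surjective k
  have hc : c ∈ borelGroup ℓ := mem_borelGroup_of_conj_unip
    (mem_borelSubgroup.1 (h _ (unip_mem_borelSubgroup K 1))).1
  obtain ⟨_, h'⟩ := mem_borelSubgroup.1 (h g (mem_borelSubgroup.2 ⟨g.2, hk⟩))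
  rw [← borelDiag_conj ⟨c, hc⟩ g]
  exact h'

theorem exists_eq_borelSubgroup {H : Subgroup (GL2 ℓ)} (hB : H ≤ borelGroup ℓ)
    (hU : ∀ b, unip b ∈ H) : ∃ K, borelSubgroup K = H := by
  refine ⟨(H.subgroupOf (borelGroup ℓ)).map (borelDiag ℓ), ?_⟩
  ext g
  rw [mem_borelSubgroup]
  constructor
  · rintro ⟨hg, h, hh, e⟩
    have h1 : borelDiag ℓ (h⁻¹ * ⟨g, hg⟩) = 1 := by rw [map_mul, map_inv, e, inv_mul_cancel]
    have h2 := eq_unip_of_borelDiag_eq_one h1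
    have h3 : (h⁻¹ * ⟨g, hg⟩ : borelGroup ℓ).1 ∈ H := h2 ▸ hU _
    simpa using H.mul_mem (show h.1 ∈ H from hh) h3
  · intro hg
    exact ⟨hB hg, ⟨g, hB hg⟩, hg, rfl⟩

end Borel

/-- Let `ℓ` be an odd prime. The number of conjugacy classes of subgroups of `GL₂(ℤ/ℓℤ)`
that are conjugate to a subgroup of the Borel group `B(ℓ)` and contain an element of
order `ℓ` equals `α(ℓ−1)`. -/
theorem stmt2 (ℓ : ℕ) [Fact (Nat.Prime ℓ)] (hodd : Odd ℓ) :
    conjClassCount (fun H : Subgroup (GL2 ℓ) =>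
        (∃ c : GL2 ℓ, ∀ x ∈ H, IsBorelElt (c * x * c⁻¹)) ∧
        (∃ x ∈ H, orderOf x = ℓ)) = alphaFun (ℓ - 1) := by
  have hcard : Nat.card (ZMod ℓ)ˣ = ℓ - 1 := by
    rw [Nat.card_eq_fintype_card, ZMod.card_units]
  rw [← hcard, ← IsCyclic.card_subgroup_prod_self, conjClassCount]
  symm
  refine Nat.card_eq_of_bijective (fun K => Quotient.mk _ ⟨borelSubgroup K, ⟨1, fun x hx => ?_⟩,
    unip 1, unip_mem_borelSubgroup K 1, orderOf_unip_one⟩) ⟨fun K K' h => ?_, fun q => ?_⟩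
  · rw [inv_one, mul_one, one_mul]
    exact (mem_borelSubgroup.1 hx).1
  · obtain ⟨c, hc⟩ := Quotient.exact h
    have hc' : c • borelSubgroup K' = borelSubgroup K := hc
    refine le_antisymm (le_of_conj_borelSubgroup (c := (ConjAct.ofConjAct c)⁻¹) fun g hg => ?_)
      (le_of_conj_borelSubgroup (c := ConjAct.ofConjAct c) fun g hg => ?_)
    · rw [← hc', Subgroup.mem_pointwise_smul_iff_inv_smul_mem, ConjAct.smul_def] at hg
      exact hg
    · rw [← hc', ← ConjAct.smul_def]
      exact Subgroup.smul_mem_pointwise_smul g c _ hg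
  · induction q using Quotient.inductionOn with
    | _ H =>
    obtain ⟨H, ⟨c, hc⟩, x, hx, ho⟩ := H
    have hmem (g : GL2 ℓ) (hg : g ∈ H) : c * g * c⁻¹ ∈ ConjAct.toConjAct c • H :=
      Subgroup.smul_mem_pointwise_smul g (ConjAct.toConjAct c) H hg
    have hB : ConjAct.toConjAct c • H ≤ borelGroup ℓ := by
      rintro _ ⟨g, hg, rfl⟩
      exact hc g hg
    have ho' : orderOf (c * x * c⁻¹) = ℓ := by
      exact (orderOf_injective (MulAut.conj c).toMonoidHom (MulAut.conj c).injective x).trans ho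
    obtain ⟨K, hK⟩ := exists_eq_borelSubgroup hB
      (unip_mem_of_orderOf_eq (hmem x hx) (hB (hmem x hx)) ho')
    exact ⟨K, Quotient.sound ⟨ConjAct.toConjAct c, hK.symm⟩⟩
end

section
/- Let ℓ be an odd prime, let G and H be subgroups of the split Cartan group C_s(ℓ) that are conjugate in GL₂(ℤ/ℓℤ), and let t = [[1,1],[0,1]]. Then the subgroups G' = ⟨G, t⟩ and H' = ⟨H, t⟩ of GL₂(ℓ) are locally conjugate in GL₂(ℓ) and are isomorphic as abstract groups. -/
open Matrix

/-- Membership in the split Cartan group `C_s(ℓ)` of diagonal matrices. -/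
def IsDiagElt {ℓ : ℕ} (g : GL2 ℓ) : Prop := mat g 0 1 = 0 ∧ mat g 1 0 = 0

/-- The matrix `t = [[1,1],[0,1]]` as an element of `GL₂(ℤ/ℓℤ)`. -/
def tGL (ℓ : ℕ) : GL2 ℓ :=
  ⟨!![1, 1; 0, 1], !![1, -1; 0, 1], by
      ext i j
      fin_cases i <;> fin_cases j <;>
        simp [Matrix.mul_apply, Fin.sum_univ_two, Matrix.one_apply], by
      ext i j
      fin_cases i <;> fin_cases j <;>
        simp [Matrix.mul_apply, Fin.sum_univ_two, Matrix.one_apply]⟩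

/-- Two subgroups of `GL₂(ℤ/ℓℤ)` are locally conjugate if there is a bijection between
them carrying each element to a `GL₂(ℤ/ℓℤ)`-conjugate of itself. -/
def LocallyConjugate {ℓ : ℕ} (G H : Subgroup (GL2 ℓ)) : Prop :=
  ∃ f : G ≃ H, ∀ g : G, IsConj (g : GL2 ℓ) ((f g : H) : GL2 ℓ)

/-- Reflection of a `2 × 2` matrix in its antidiagonal. -/
def antitranspose {R : Type*} (A : Matrix (Fin 2) (Fin 2) R) : Matrix (Fin 2) (Fin 2) R :=
  !![A 1 1, A 0 1; A 1 0, A 0 0]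

theorem antitranspose_mul {R : Type*} [CommRing R] (A B : Matrix (Fin 2) (Fin 2) R) :
    antitranspose (A * B) = antitranspose B * antitranspose A := by
  ext i j
  fin_cases i <;> fin_cases j <;>
    simp [antitranspose, Matrix.mul_apply, Fin.sum_univ_two] <;> ring

theorem antitranspose_one {R : Type*} [CommRing R] :
    antitranspose (1 : Matrix (Fin 2) (Fin 2) R) = 1 := by
  ext i j
  fin_cases i <;> fin_cases j <;> simp [antitranspose]

theorem antitranspose_antitranspose {R : Type*} (A : Matrix (Fin 2) (Fin 2) R) :
    antitranspose (antitranspose A) = A := by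
  ext i j
  fin_cases i <;> fin_cases j <;> simp [antitranspose]

/-- The automorphism of `GL₂` sending `g` to the antitranspose of its inverse. -/
def antitransposeInv (R : Type*) [CommRing R] : GL (Fin 2) R ≃* GL (Fin 2) R where
  toFun g := ⟨antitranspose (g⁻¹ : GL (Fin 2) R).val, antitranspose g.val,
    by rw [← antitranspose_mul, Units.mul_inv, antitranspose_one],
    by rw [← antitranspose_mul, Units.inv_mul, antitranspose_one]⟩
  invFun g := ⟨antitranspose (g⁻¹ : GL (Fin 2) R).val, antitranspose g.val,
    by rw [← antitranspose_mul, Units.mul_inv, antitranspose_one],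
    by rw [← antitranspose_mul, Units.inv_mul, antitranspose_one]⟩
  left_inv g := Units.ext (antitranspose_antitranspose g.val)
  right_inv g := Units.ext (antitranspose_antitranspose g.val)
  map_mul' g h := Units.ext <|
    (congrArg (fun x : GL (Fin 2) R => antitranspose x.val) (mul_inv_rev g h)).trans
      (antitranspose_mul _ _)

theorem val_inv_antitransposeInv {R : Type*} [CommRing R] (g : GL (Fin 2) R) :
    ((antitransposeInv R g)⁻¹).val = antitranspose g.val := rfl

/-- A conjugating matrix of nonzero determinant witnesses conjugacy in `GL₂`. -/
theorem isConj_of_mul_eq_mul {K : Type*} [Field K] {g h : GL (Fin 2) K}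
    (P : Matrix (Fin 2) (Fin 2) K) (hP : P.det ≠ 0) (e : P * g.val = h.val * P) :
    IsConj g h := by
  refine isConj_iff.2 ⟨GeneralLinearGroup.mkOfDetNeZero P hP, ?_⟩
  rw [mul_inv_eq_iff_eq_mul]
  exact Units.ext e

theorem isConj_inv_antitransposeInv {K : Type*} [Field K] (g : GL (Fin 2) K) :
    IsConj g (antitransposeInv K g)⁻¹ := by
  by_cases hb : g.val 0 1 = 0
  · by_cases hc : g.val 1 0 = 0
    · refine isConj_of_mul_eq_mul !![0, 1; 1, 0] (by simp) ?_
      rw [val_inv_antitransposeInv]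
      ext i j
      fin_cases i <;> fin_cases j <;>
        simp [antitranspose, Matrix.mul_apply, Fin.sum_univ_two, hb, hc]
    · refine isConj_of_mul_eq_mul
        !![1, (g.val 1 1 - g.val 0 0) / g.val 1 0; 0, 1] (by simp) ?_
      rw [val_inv_antitransposeInv]
      ext i j
      fin_cases i <;> fin_cases j <;>
        simp [antitranspose, Matrix.mul_apply, Fin.sum_univ_two] <;> field_simp <;> ring
  · refine isConj_of_mul_eq_mul
      !![1, 0; (g.val 0 0 - g.val 1 1) / g.val 0 1, 1] (by simp) ?_
    rw [val_inv_antitransposeInv]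
    ext i j
    fin_cases i <;> fin_cases j <;>
      simp [antitranspose, Matrix.mul_apply, Fin.sum_univ_two] <;> field_simp <;> ring

theorem antitransposeInv_tGL (ℓ : ℕ) : antitransposeInv (ZMod ℓ) (tGL ℓ) = (tGL ℓ)⁻¹ := by
  rw [← _root_.inv_inj, inv_inv]
  refine Units.ext ?_
  rw [val_inv_antitransposeInv]
  simp [antitranspose, tGL]

/-- If conjugation by `c` preserves diagonality of a nonscalar diagonal matrix, then `c` is
diagonal or antidiagonal. -/
theorem diag_or_antidiag_of_conj {ℓ : ℕ} [Fact (Nat.Prime ℓ)] {c g h : GL2 ℓ}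
    (hg : IsDiagElt g) (hh : IsDiagElt h) (hne : mat g 0 0 ≠ mat g 1 1) (e : c * g = h * c) :
    IsDiagElt c ∨ (mat c 0 0 = 0 ∧ mat c 1 1 = 0) := by
  obtain ⟨hg1, hg2⟩ := hg
  obtain ⟨hh1, hh2⟩ := hh
  have e' (i j : Fin 2) : (mat c * mat g) i j = (mat h * mat c) i j :=
    congrArg (fun x : GL2 ℓ => mat x i j) e
  have e00 := e' 0 0
  have e01 := e' 0 1
  have e10 := e' 1 0
  have e11 := e' 1 1
  simp only [Matrix.mul_apply, Fin.sum_univ_two, hg1, hg2, hh1, hh2, mul_zero, zero_mul,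
    add_zero, zero_add] at e00 e01 e10 e11
  have hdet : (mat c).det ≠ 0 := ((Matrix.isUnit_iff_isUnit_det _).1 c.isUnit).ne_zero
  rw [Matrix.det_fin_two] at hdet
  have hsub := sub_ne_zero.2 hne
  have r0 : mat c 0 0 * mat c 0 1 = 0 :=
    (mul_eq_zero.1 (show (mat g 0 0 - mat g 1 1) * (mat c 0 0 * mat c 0 1) = 0 by
      linear_combination mat c 0 1 * e00 - mat c 0 0 * e01)).resolve_left hsub
  have r1 : mat c 1 0 * mat c 1 1 = 0 :=
    (mul_eq_zero.1 (show (mat g 0 0 - mat g 1 1) * (mat c 1 0 * mat c 1 1) = 0 by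
      linear_combination mat c 1 1 * e10 - mat c 1 0 * e11)).resolve_left hsub
  unfold IsDiagElt
  rcases mul_eq_zero.1 r0 with h0 | h0 <;> rcases mul_eq_zero.1 r1 with h1 | h1 <;> simp_all

theorem conj_eq_self_of_isDiagElt {ℓ : ℕ} {c g : GL2 ℓ} (hg : IsDiagElt g)
    (h : IsDiagElt c ∨ mat g 0 0 = mat g 1 1) : c * g * c⁻¹ = g := by
  obtain ⟨hg1, hg2⟩ := hg
  rw [mul_inv_eq_iff_eq_mul]
  refine Units.ext (show mat c * mat g = mat g * mat c from ?_)
  ext i j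
  rcases h with ⟨h1, h2⟩ | h
  · fin_cases i <;> fin_cases j <;>
      simp [Matrix.mul_apply, Fin.sum_univ_two, hg1, hg2, h1, h2, mul_comm]
  · fin_cases i <;> fin_cases j <;>
      simp [Matrix.mul_apply, Fin.sum_univ_two, hg1, hg2, h] <;> ring

theorem conj_eq_inv_antitransposeInv {ℓ : ℕ} {c g : GL2 ℓ} (hg : IsDiagElt g)
    (h0 : mat c 0 0 = 0) (h1 : mat c 1 1 = 0) :
    c * g * c⁻¹ = (antitransposeInv (ZMod ℓ) g)⁻¹ := by
  obtain ⟨hg1, hg2⟩ := hg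
  rw [mul_inv_eq_iff_eq_mul]
  refine Units.ext (show mat c * mat g = antitranspose (mat g) * mat c from ?_)
  ext i j
  fin_cases i <;> fin_cases j <;>
    simp [antitranspose, Matrix.mul_apply, Fin.sum_univ_two, hg1, hg2, h0, h1] <;> ring

/-- Conjugate groups of diagonal matrices are equal or are exchanged by `antitransposeInv`. -/
theorem eq_or_map_antitransposeInv_eq {ℓ : ℕ} [Fact (Nat.Prime ℓ)] {G H : Subgroup (GL2 ℓ)}
    (hG : ∀ g ∈ G, IsDiagElt g) (hH : ∀ g ∈ H, IsDiagElt g) {c : GL2 ℓ}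
    (hc : Subgroup.map (MulAut.conj c).toMonoidHom G = H) :
    G = H ∨ Subgroup.map (antitransposeInv (ZMod ℓ)).toMonoidHom G = H := by
  have hmem (x : GL2 ℓ) : x ∈ H ↔ ∃ g ∈ G, c * g * c⁻¹ = x := by
    simp [← hc, Subgroup.mem_map]
  have heq (h : ∀ g ∈ G, c * g * c⁻¹ = g) : G = H := by
    ext x
    rw [hmem]
    constructor
    · exact fun hx => ⟨x, hx, h x hx⟩
    · rintro ⟨g, hg, rfl⟩
      rwa [h g hg]
  by_cases hs : ∀ g ∈ G, mat g 0 0 = mat g 1 1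
  · exact .inl (heq fun g hg => conj_eq_self_of_isDiagElt (hG g hg) (.inr (hs g hg)))
  · push Not at hs
    obtain ⟨g, hg, hne⟩ := hs
    rcases diag_or_antidiag_of_conj (c := c) (hG g hg) (hH _ ((hmem _).2 ⟨g, hg, rfl⟩)) hne
      (by group) with h | ⟨h0, h1⟩
    · exact .inl (heq fun g hg => conj_eq_self_of_isDiagElt (hG g hg) (.inl h))
    · right
      ext x
      rw [hmem, Subgroup.mem_map]
      constructor
      · rintro ⟨g, hg, rfl⟩
        refine ⟨g⁻¹, inv_mem hg, ?_⟩
        rw [conj_eq_inv_antitransposeInv (hG _ (inv_mem hg)) h0 h1, map_inv, inv_inv]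
        rfl
      · rintro ⟨g, hg, rfl⟩
        refine ⟨g⁻¹, inv_mem hg, ?_⟩
        rw [conj_eq_inv_antitransposeInv (hG g hg) h0 h1]
        exact map_inv _ g

/-- Let `ℓ` be an odd prime, let `G` and `H` be subgroups of the split Cartan group
`C_s(ℓ)` that are conjugate in `GL₂(ℤ/ℓℤ)`, and let `t = [[1,1],[0,1]]`.  Then the
subgroups `G' = ⟨G, t⟩` and `H' = ⟨H, t⟩` are locally conjugate in `GL₂(ℤ/ℓℤ)` and are
isomorphic as abstract groups. -/
theorem stmt3 (ℓ : ℕ) [Fact (Nat.Prime ℓ)] (hodd : Odd ℓ)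
    (G H : Subgroup (GL2 ℓ))
    (hG : ∀ g ∈ G, IsDiagElt g) (hH : ∀ g ∈ H, IsDiagElt g)
    (hconj : ∃ c : GL2 ℓ, Subgroup.map (MulAut.conj c).toMonoidHom G = H) :
    LocallyConjugate (G ⊔ Subgroup.zpowers (tGL ℓ)) (H ⊔ Subgroup.zpowers (tGL ℓ)) ∧
    Nonempty (↥(G ⊔ Subgroup.zpowers (tGL ℓ)) ≃* ↥(H ⊔ Subgroup.zpowers (tGL ℓ))) := by
  obtain ⟨c, hc⟩ := hconj
  rcases eq_or_map_antitransposeInv_eq hG hH hc with rfl | hmap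
  · exact ⟨⟨Equiv.refl _, fun _ => IsConj.refl _⟩, ⟨MulEquiv.refl _⟩⟩
  · have hsup : Subgroup.map (antitransposeInv (ZMod ℓ)).toMonoidHom
        (G ⊔ Subgroup.zpowers (tGL ℓ)) = H ⊔ Subgroup.zpowers (tGL ℓ) := by
      rw [Subgroup.map_sup, hmap, MonoidHom.map_zpowers]
      change H ⊔ Subgroup.zpowers (antitransposeInv (ZMod ℓ) (tGL ℓ)) = _
      rw [antitransposeInv_tGL, Subgroup.zpowers_inv]
    rw [← hsup]
    let φ := (antitransposeInv (ZMod ℓ)).subgroupMap (G ⊔ Subgroup.zpowers (tGL ℓ))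
    exact ⟨⟨φ.toEquiv.trans (Equiv.inv _), fun g => isConj_inv_antitransposeInv (g : GL2 ℓ)⟩, ⟨φ⟩⟩
end

section
/- Let ℓ be an odd prime. The number of subgroups H of the split Cartan group C_s(ℓ) that are normal subgroups of its normalizer C_s⁺(ℓ) equals β(ℓ−1). -/
open Matrix

/-- Antidiagonal matrices: the nontrivial coset of `C_s(ℓ)` in its normalizer `C_s⁺(ℓ)`,
so that `C_s⁺(ℓ) = C_s(ℓ) ∪ [[0,1],[1,0]]·C_s(ℓ)` consists of the diagonal and
antidiagonal invertible matrices. -/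
def IsAntidiagElt {ℓ : ℕ} (g : GL2 ℓ) : Prop := mat g 0 0 = 0 ∧ mat g 1 1 = 0

/-- `β(n) = β₂(n) · ∏_{p odd prime, p | n} (v_p(n)+1)²`, where
`β₂(n) = 2·v₂(n)² − 2·v₂(n) + 3` if `n` is even and `β₂(n) = 1` if `n` is odd. -/
def betaFun (n : ℕ) : ℕ :=
  (if 2 ∣ n then 2 * (n.factorization 2) ^ 2 - 2 * (n.factorization 2) + 3 else 1) *
    ∏ p ∈ n.primeFactors.erase 2, (n.factorization p + 1) ^ 2

open scoped ArithmeticFunction.sigma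

/-- The number of square roots of `1` modulo `m`, extended by `0` at `m = 0`. -/
noncomputable def sqrtOneCard : ArithmeticFunction ℕ :=
  ⟨fun m => if m = 0 then 0 else Nat.card {u : ZMod m // u * u = 1}, by simp⟩

theorem sqrtOneCard_apply {m : ℕ} (hm : m ≠ 0) :
    sqrtOneCard m = Nat.card {u : ZMod m // u * u = 1} := by
  simp [sqrtOneCard, hm]

theorem sqrtOneCard_isMultiplicative : sqrtOneCard.IsMultiplicative := by
  rw [ArithmeticFunction.IsMultiplicative.iff_ne_zero]
  refine ⟨?_, fun {m n} hm hn hmn => ?_⟩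
  · rw [sqrtOneCard_apply one_ne_zero, Nat.card_eq_one_iff_unique]
    exact ⟨⟨fun a b => Subtype.ext (Subsingleton.elim _ _)⟩, ⟨⟨1, by simp⟩⟩⟩
  · rw [sqrtOneCard_apply hm, sqrtOneCard_apply hn, sqrtOneCard_apply (mul_ne_zero hm hn),
      ← Nat.card_prod]
    let e := ZMod.chineseRemainder hmn
    refine Nat.card_congr ((e.toEquiv.subtypeEquiv (q := fun w => w.1 * w.1 = 1 ∧ w.2 * w.2 = 1)
      fun u => ?_).trans (Equiv.subtypeProdEquivProd
      (p := fun u : ZMod m => u * u = 1) (q := fun u : ZMod n => u * u = 1)))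
    rw [← e.injective.eq_iff, map_mul, map_one, Prod.ext_iff]
    rfl

theorem exists_int_of_mul_self_eq_one {m : ℕ} (u : ZMod m) (hu : u * u = 1) :
    ∃ x : ℤ, (x : ZMod m) = u ∧ (m : ℤ) ∣ (x - 1) * (x + 1) := by
  obtain ⟨x, rfl⟩ := ZMod.intCast_surjective u
  refine ⟨x, rfl, ?_⟩
  rw [← ZMod.intCast_zmod_eq_zero_iff_dvd]
  push_cast
  linear_combination hu

theorem sqrtOneCard_odd_prime_pow {p : ℕ} (hp : p.Prime) (hp2 : p ≠ 2) (k : ℕ) :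
    sqrtOneCard (p ^ (k + 1)) = 2 := by
  have hpk : p ∣ p ^ (k + 1) := dvd_pow_self p (Nat.succ_ne_zero k)
  have h2 : ¬ (p : ℤ) ∣ 2 := fun h =>
    hp2 ((Nat.prime_dvd_prime_iff_eq hp Nat.prime_two).1 (by exact_mod_cast h))
  have hp' : Prime (p : ℤ) := Nat.prime_iff_prime_int.1 hp
  have key : ∀ u : ZMod (p ^ (k + 1)), u * u = 1 ↔ u = 1 ∨ u = -1 := by
    intro u
    refine ⟨fun hu => ?_, by rintro (rfl | rfl) <;> simp⟩
    obtain ⟨x, rfl, hx⟩ := exists_int_of_mul_self_eq_one u hu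
    have h : ((p ^ (k + 1) : ℕ) : ℤ) ∣ x - 1 ∨ ((p ^ (k + 1) : ℕ) : ℤ) ∣ x + 1 := by
      push_cast at hx ⊢
      by_cases h : (p : ℤ) ∣ x - 1
      · left
        refine hp'.pow_dvd_of_dvd_mul_right _ (fun h' => h2 ?_) hx
        have := dvd_sub h' h
        ring_nf at this
        exact this
      · right
        exact hp'.pow_dvd_of_dvd_mul_left _ h hx
    refine h.imp (fun h => ?_) (fun h => ?_) <;>
      rw [← ZMod.intCast_zmod_eq_zero_iff_dvd] at h <;> push_cast at h
    · exact sub_eq_zero.1 h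
    · exact eq_neg_of_add_eq_zero_left h
  have hne : (1 : ZMod (p ^ (k + 1))) ≠ -1 := by
    intro h
    have h' : ((2 : ℤ) : ZMod (p ^ (k + 1))) = 0 := by
      push_cast
      linear_combination h
    rw [ZMod.intCast_zmod_eq_zero_iff_dvd] at h'
    exact h2 ((Int.natCast_dvd_natCast.2 hpk).trans h')
  rw [sqrtOneCard_apply (pow_ne_zero _ hp.ne_zero)]
  simp_rw [key]
  exact (Set.ncard_pair hne)

theorem sqrtOneCard_two_pow (k : ℕ) : sqrtOneCard (2 ^ (k + 3)) = 4 := by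
  have hN : ((2 ^ (k + 3) : ℕ) : ℤ) = 8 * 2 ^ k := by push_cast; ring
  set s : ZMod (2 ^ (k + 3)) := ((4 * 2 ^ k : ℤ) : ZMod (2 ^ (k + 3))) with hs
  have hdvd : ∀ z : ℤ, (z : ZMod (2 ^ (k + 3))) = 0 ↔ (8 * 2 ^ k : ℤ) ∣ z := fun z => by
    rw [ZMod.intCast_zmod_eq_zero_iff_dvd, hN]
  have hpos : (0 : ℤ) < 2 ^ k := by positivity
  have hs2 : 2 * s = 0 := by
    have := (hdvd (2 * (4 * 2 ^ k))).2 ⟨1, by ring⟩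
    rw [hs]; push_cast at this ⊢; exact this
  have hss : s * s = 0 := by
    have := (hdvd ((4 * 2 ^ k) * (4 * 2 ^ k))).2 ⟨2 * 2 ^ k, by ring⟩
    rw [hs]; push_cast at this ⊢; exact this
  have key : ∀ u : ZMod (2 ^ (k + 3)), u * u = 1 ↔
      u ∈ ({1, -1, 1 + s, -1 + s} : Set (ZMod (2 ^ (k + 3)))) := by
    intro u
    simp only [Set.mem_insert_iff, Set.mem_singleton_iff]
    constructor
    · intro hu
      obtain ⟨x, rfl, hx⟩ := exists_int_of_mul_self_eq_one u hu
      rw [hN] at hx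
      have hodd : Odd x := by
        by_contra h
        rw [Int.not_odd_iff_even] at h
        obtain ⟨y, rfl⟩ := h
        obtain ⟨c, hc⟩ := hx
        have : 2 * (2 * y * y - 4 * 2 ^ k * c) = 1 := by linear_combination hc
        omega
      obtain ⟨w, rfl⟩ := hodd
      have hw : (2 : ℤ) ^ (k + 1) ∣ w * (w + 1) := by
        obtain ⟨c, hc⟩ := hx
        exact ⟨c, by rw [pow_succ]; linarith⟩
      have h : (2 : ℤ) ^ (k + 1) ∣ w ∨ (2 : ℤ) ^ (k + 1) ∣ w + 1 := by
        by_cases h : (2 : ℤ) ∣ w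
        · left
          exact Int.prime_two.pow_dvd_of_dvd_mul_right _ (by omega) hw
        · right
          exact Int.prime_two.pow_dvd_of_dvd_mul_left _ h hw
      have hpar : ∀ c : ℤ, ((4 * 2 ^ k * c : ℤ) : ZMod (2 ^ (k + 3))) = 0 ∨
          ((4 * 2 ^ k * c : ℤ) : ZMod (2 ^ (k + 3))) = s := by
        intro c
        obtain ⟨d, rfl | rfl⟩ := Int.even_or_odd' c
        · left; exact (hdvd _).2 ⟨d, by ring⟩
        · right
          rw [hs, ← sub_eq_zero, ← Int.cast_sub]
          exact (hdvd _).2 ⟨d, by ring⟩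
      rcases h with ⟨c, hc⟩ | ⟨c, hc⟩
      · have hx : 2 * w + 1 = 4 * 2 ^ k * c + 1 := by rw [hc]; ring
        rw [hx, Int.cast_add, Int.cast_one]
        rcases hpar c with h | h <;> rw [h]
        · left; ring
        · right; right; left; ring
      · have hx : 2 * w + 1 = 4 * 2 ^ k * c + (-1) := by
          rw [pow_succ] at hc; linarith
        rw [hx, Int.cast_add, Int.cast_neg, Int.cast_one]
        rcases hpar c with h | h <;> rw [h]
        · right; left; ring
        · right; right; right; ring
    · rintro (rfl | rfl | rfl | rfl)
      · ring
      · ring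
      · linear_combination hs2 + hss
      · linear_combination -hs2 + hss
  have hne : ∀ z : ℤ, z ≠ 0 → |z| < 8 * 2 ^ k → (z : ZMod (2 ^ (k + 3))) ≠ 0 :=
    fun z hz hlt h => hz (Int.eq_zero_of_abs_lt_dvd ((hdvd z).1 h) hlt)
  have h2 : (2 : ZMod (2 ^ (k + 3))) ≠ 0 := by
    simpa using hne 2 (by norm_num) (by norm_num; linarith)
  have hs0 : s ≠ 0 := hne _ (by positivity) (by rw [abs_of_pos (by positivity)]; linarith)
  have h2s : 2 + s ≠ 0 := by
    have := hne (2 + 4 * 2 ^ k) (by positivity) (by rw [abs_of_pos (by positivity)]; linarith)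
    rw [hs]; push_cast at this ⊢; exact this
  have h2s' : 2 - s ≠ 0 := fun h => h2s (by linear_combination h + hs2)
  rw [sqrtOneCard_apply (by positivity)]
  simp_rw [key]
  change Set.ncard _ = 4
  rw [Set.ncard_insert_of_notMem, Set.ncard_insert_of_notMem, Set.ncard_pair]
  · intro h; apply h2; linear_combination h
  · simp only [Set.mem_insert_iff, Set.mem_singleton_iff, not_or]
    exact ⟨fun h => h2s (by linear_combination -h), fun h => hs0 (by linear_combination -h)⟩
  · simp only [Set.mem_insert_iff, Set.mem_singleton_iff, not_or]
    exact ⟨fun h => h2 (by linear_combination h), fun h => hs0 (by linear_combination -h),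
      fun h => h2s' (by linear_combination h)⟩

theorem sqrtOneCard_two : sqrtOneCard 2 = 1 := by
  rw [sqrtOneCard_apply two_ne_zero, Nat.card_eq_fintype_card]
  decide

theorem sqrtOneCard_four : sqrtOneCard 4 = 2 := by
  rw [sqrtOneCard_apply four_ne_zero, Nat.card_eq_fintype_card]
  decide

theorem sqrtOneCard_one : sqrtOneCard 1 = 1 := sqrtOneCard_isMultiplicative.1

theorem sqrtOneCard_mul_sigma_prime_pow {p : ℕ} (hp : p.Prime) (k : ℕ) :
    (sqrtOneCard * σ 0) (p ^ k) =
      ∑ i ∈ Finset.range (k + 1), sqrtOneCard (p ^ i) * (k - i + 1) := by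
  rw [ArithmeticFunction.mul_apply, Nat.sum_divisorsAntidiagonal (fun a b => sqrtOneCard a * σ 0 b),
    Nat.sum_divisors_prime_pow hp]
  refine Finset.sum_congr rfl fun i hi => ?_
  rw [Nat.pow_div (Finset.mem_range_succ_iff.1 hi) hp.pos,
    ArithmeticFunction.sigma_zero_apply_prime_pow hp]

theorem sqrtOneCard_mul_sigma_odd_prime_pow {p : ℕ} (hp : p.Prime) (hp2 : p ≠ 2) (k : ℕ) :
    (sqrtOneCard * σ 0) (p ^ k) = (k + 1) ^ 2 := by
  rw [sqrtOneCard_mul_sigma_prime_pow hp, Finset.sum_range_succ']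
  simp_rw [sqrtOneCard_odd_prime_pow hp hp2, pow_zero, sqrtOneCard_one]
  rw [← Finset.sum_range_reflect]
  have : ∀ i ∈ Finset.range k, 2 * (k - (k - 1 - i + 1) + 1) = 2 * (i + 1) := fun i hi => by
    have := Finset.mem_range.1 hi
    omega
  rw [Finset.sum_congr rfl this]
  clear this
  simp only [Nat.sub_zero, one_mul]
  induction k with
  | zero => rfl
  | succ k ih => rw [Finset.sum_range_succ]; linarith

theorem sqrtOneCard_mul_sigma_two_pow (k : ℕ) :
    (sqrtOneCard * σ 0) (2 ^ (k + 1)) = 2 * (k + 1) ^ 2 - 2 * (k + 1) + 3 := by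
  rw [sqrtOneCard_mul_sigma_prime_pow Nat.prime_two]
  have hR : 2 * (k + 1) ^ 2 - 2 * (k + 1) + 3 = 2 * (k * (k + 1)) + 3 := by
    rw [show 2 * (k + 1) ^ 2 = 2 * (k * (k + 1)) + 2 * (k + 1) by ring, Nat.add_sub_cancel]
  rw [hR]
  clear hR
  obtain _ | k := k
  · simp [Finset.sum_range_succ, sqrtOneCard_one, sqrtOneCard_two]
  rw [Finset.sum_range_succ', Finset.sum_range_succ', Finset.sum_range_succ']
  simp only [zero_add, pow_zero, pow_one, Nat.reduceAdd, Nat.reducePow, add_assoc,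
    sqrtOneCard_two_pow, sqrtOneCard_one, sqrtOneCard_two, sqrtOneCard_four]
  rw [← Finset.sum_range_reflect]
  have : ∀ i ∈ Finset.range k, 4 * (k + 2 - (k - 1 - i + 3) + 1) = 4 * (i + 1) := fun i hi => by
    have := Finset.mem_range.1 hi
    omega
  rw [Finset.sum_congr rfl this]
  clear this
  simp only [Nat.sub_zero, one_mul, Nat.add_sub_cancel, Nat.reduceSubDiff]
  induction k with
  | zero => rfl
  | succ k ih => rw [Finset.sum_range_succ]; linarith

theorem sqrtOneCard_mul_sigma_eq_betaFun {n : ℕ} (hn : n ≠ 0) :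
    (sqrtOneCard * σ 0) n = betaFun n := by
  rw [(sqrtOneCard_isMultiplicative.mul
    ArithmeticFunction.isMultiplicative_sigma).multiplicative_factorization _ hn, Finsupp.prod,
    Nat.support_factorization, betaFun]
  have hodd : ∏ p ∈ n.primeFactors.erase 2, (sqrtOneCard * σ 0) (p ^ n.factorization p) =
      ∏ p ∈ n.primeFactors.erase 2, (n.factorization p + 1) ^ 2 :=
    Finset.prod_congr rfl fun p hp => by
      rw [Finset.mem_erase] at hp
      exact sqrtOneCard_mul_sigma_odd_prime_pow (Nat.prime_of_mem_primeFactors hp.2) hp.1 _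
  rw [← hodd]
  split_ifs with h2
  · have hmem : 2 ∈ n.primeFactors := Nat.mem_primeFactors.2 ⟨Nat.prime_two, h2, hn⟩
    rw [← Finset.mul_prod_erase _ _ hmem]
    obtain ⟨k, hk⟩ := Nat.exists_eq_succ_of_ne_zero
      (Nat.prime_two.factorization_pos_of_dvd hn h2).ne'
    rw [hk, Nat.succ_eq_add_one, sqrtOneCard_mul_sigma_two_pow]
  · rw [Finset.erase_eq_of_notMem (fun h => h2 (Nat.dvd_of_mem_primeFactors h)), one_mul]

/-- The lattice of pairs `(a * s, a * t)` with `t ≡ u * s` modulo `m`. -/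
def graphLattice (a m : ℕ) (u : ZMod m) : AddSubgroup (ℤ × ℤ) where
  carrier := {x | ∃ s t : ℤ, x = (a * s, a * t) ∧ (t : ZMod m) = u * s}
  zero_mem' := ⟨0, 0, by simp [Prod.zero_eq_mk]⟩
  add_mem' := by
    rintro _ _ ⟨s, t, rfl, h⟩ ⟨s', t', rfl, h'⟩
    exact ⟨s + s', t + t', by simp [mul_add], by push_cast; rw [h, h']; ring⟩
  neg_mem' := by
    rintro _ ⟨s, t, rfl, h⟩
    exact ⟨-s, -t, by simp, by push_cast; rw [h]; ring⟩

theorem mem_graphLattice {a m : ℕ} {u : ZMod m} {x : ℤ × ℤ} :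
    x ∈ graphLattice a m u ↔ ∃ s t : ℤ, x = (a * s, a * t) ∧ (t : ZMod m) = u * s :=
  Iff.rfl

theorem graphLattice_left_dvd {a m a' m' : ℕ} {u : ZMod m} {u' : ZMod m'}
    (h : graphLattice a m u ≤ graphLattice a' m' u') : a' ∣ a := by
  obtain ⟨v, hv⟩ := ZMod.intCast_surjective u
  obtain ⟨s, t, hst, -⟩ := h (mem_graphLattice.2 ⟨1, v, rfl, by simp [hv]⟩)
  rw [Prod.mk.injEq, mul_one] at hst
  exact Int.natCast_dvd_natCast.1 ⟨s, hst.1⟩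

theorem graphLattice_right_dvd {a m m' : ℕ} (ha : a ≠ 0) {u : ZMod m} {u' : ZMod m'}
    (h : graphLattice a m u ≤ graphLattice a m' u') : m' ∣ m := by
  obtain ⟨s, t, hst, htu⟩ := h (mem_graphLattice.2 ⟨0, m, rfl, by simp⟩)
  have ha' : (a : ℤ) ≠ 0 := by exact_mod_cast ha
  rw [Prod.mk.injEq, mul_right_inj' ha', mul_right_inj' ha'] at hst
  obtain ⟨rfl, rfl⟩ := hst
  rw [Int.cast_zero, mul_zero, ZMod.intCast_zmod_eq_zero_iff_dvd] at htu
  exact Int.natCast_dvd_natCast.1 htu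

theorem eq_of_graphLattice_le {a m : ℕ} (ha : a ≠ 0) {u u' : ZMod m}
    (h : graphLattice a m u ≤ graphLattice a m u') : u = u' := by
  obtain ⟨v, hv⟩ := ZMod.intCast_surjective u
  obtain ⟨s, t, hst, htu⟩ := h (mem_graphLattice.2 ⟨1, v, rfl, by simp [hv]⟩)
  have ha' : (a : ℤ) ≠ 0 := by exact_mod_cast ha
  rw [Prod.mk.injEq, mul_right_inj' ha', mul_right_inj' ha'] at hst
  obtain ⟨rfl, rfl⟩ := hst
  simpa [hv] using htu

/-- The swap-invariant subgroups of `ℤ × ℤ` containing `n * (ℤ × ℤ)`. -/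
def SwapLattice (n : ℕ) : Type :=
  {L : AddSubgroup (ℤ × ℤ) // (∀ x ∈ L, x.swap ∈ L) ∧ ((n : ℤ), (0 : ℤ)) ∈ L}

theorem exists_eq_graphLattice {n : ℕ} (hn : n ≠ 0) {L : AddSubgroup (ℤ × ℤ)}
    (hswap : ∀ x ∈ L, x.swap ∈ L) (hL : ((n : ℤ), (0 : ℤ)) ∈ L) :
    ∃ a m : ℕ, a * m ∣ n ∧ ∃ u : ZMod m, u * u = 1 ∧ graphLattice a m u = L := by
  have gen : ∀ P : AddSubgroup ℤ, ∃ a : ℕ, ∀ x : ℤ, x ∈ P ↔ (a : ℤ) ∣ x := fun P => by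
    obtain ⟨b, rfl⟩ := Int.subgroup_cyclic P
    refine ⟨b.natAbs, fun x => ?_⟩
    rw [← AddSubgroup.zmultiples_eq_closure, Int.mem_zmultiples_iff, Int.natAbs_dvd]
  obtain ⟨a, ha⟩ := gen (L.map (AddMonoidHom.fst ℤ ℤ))
  obtain ⟨d, hd⟩ := gen (L.comap (AddMonoidHom.inr ℤ ℤ))
  have ha₁ : ∀ x y : ℤ, (x, y) ∈ L → (a : ℤ) ∣ x := fun x y h => (ha x).1 ⟨_, h, rfl⟩
  have ha₂ : ∀ x y : ℤ, (x, y) ∈ L → (a : ℤ) ∣ y := fun x y h => ha₁ _ _ (hswap _ h)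
  have hd' : ∀ y : ℤ, ((0 : ℤ), y) ∈ L ↔ (d : ℤ) ∣ y := hd
  have hdL : ((0 : ℤ), (d : ℤ)) ∈ L := (hd' d).2 dvd_rfl
  obtain ⟨m, rfl⟩ : a ∣ d := Int.natCast_dvd_natCast.1 (ha₂ _ _ hdL)
  have hamn : a * m ∣ n := Int.natCast_dvd_natCast.1 ((hd' n).1 (hswap _ hL))
  have ha0 : (a : ℤ) ≠ 0 := by
    rintro h
    rw [Nat.cast_eq_zero] at h
    subst h
    exact hn (by simpa using hamn)
  have hdvd : ∀ z : ℤ, ((0 : ℤ), (a : ℤ) * z) ∈ L ↔ (z : ZMod m) = 0 := fun z => by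
    rw [hd', ZMod.intCast_zmod_eq_zero_iff_dvd, Nat.cast_mul, mul_dvd_mul_iff_left ha0]
  obtain ⟨⟨x, y⟩, hxy, rfl : x = a⟩ := (ha a).2 dvd_rfl
  obtain ⟨v, rfl⟩ := ha₂ _ _ hxy
  have hmem : ∀ s t : ℤ, ((a : ℤ) * s, (a : ℤ) * t) ∈ L ↔ (t : ZMod m) = v * s := by
    intro s t
    have hs : s • ((a : ℤ), (a : ℤ) * v) ∈ L := L.zsmul_mem hxy s
    have heq : ((a : ℤ) * s, (a : ℤ) * t) = s • ((a : ℤ), (a : ℤ) * v) + (0, a * (t - v * s)) := by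
      ext <;> simp <;> ring
    rw [heq, L.add_mem_cancel_left hs, hdvd]
    push_cast
    exact sub_eq_zero
  refine ⟨a, m, hamn, v, ?_, ?_⟩
  · have h := (hmem v 1).1 (by simpa using hswap _ hxy)
    simpa using h.symm
  · ext ⟨x, y⟩
    rw [mem_graphLattice]
    constructor
    · rintro ⟨s, t, h, hst⟩
      rw [h]
      exact (hmem s t).2 hst
    · intro h
      obtain ⟨s, rfl⟩ := ha₁ _ _ h
      obtain ⟨t, rfl⟩ := ha₂ _ _ h
      exact ⟨s, t, rfl, (hmem s t).1 h⟩

theorem graphLattice_swap_mem {a m : ℕ} {u : ZMod m} (hu : u * u = 1) {x : ℤ × ℤ}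
    (hx : x ∈ graphLattice a m u) : x.swap ∈ graphLattice a m u := by
  obtain ⟨s, t, rfl, h⟩ := hx
  exact ⟨t, s, rfl, by rw [h, ← mul_assoc, hu, one_mul]⟩

theorem natCast_zero_mem_graphLattice {a m n : ℕ} (h : a * m ∣ n) (u : ZMod m) :
    ((n : ℤ), (0 : ℤ)) ∈ graphLattice a m u := by
  obtain ⟨c, rfl⟩ := h
  exact ⟨m * c, 0, by simp [mul_assoc], by simp⟩

theorem card_swapLattice {n : ℕ} (hn : n ≠ 0) :
    Nat.card (SwapLattice n) = (sqrtOneCard * σ 0) n := by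
  let F : (Σ m : n.divisors, {u : ZMod m // u * u = 1} × (n / m).divisors) → SwapLattice n :=
    fun p => ⟨graphLattice p.2.2 p.1 p.2.1, fun _ => graphLattice_swap_mem p.2.1.2,
      natCast_zero_mem_graphLattice (by
        have h := Nat.mul_dvd_mul (Nat.dvd_of_mem_divisors p.2.2.2) (dvd_refl (p.1 : ℕ))
        rwa [Nat.div_mul_cancel (Nat.dvd_of_mem_divisors p.1.2)] at h) _⟩
  have hF : Function.Bijective F := by
    constructor
    · rintro ⟨⟨m, hm⟩, ⟨u, hu⟩, ⟨a, ha⟩⟩ ⟨⟨m', hm'⟩, ⟨u', hu'⟩, ⟨a', ha'⟩⟩ h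
      have h : graphLattice a m u = graphLattice a' m' u' := congrArg Subtype.val h
      obtain rfl : a = a' :=
        Nat.dvd_antisymm (graphLattice_left_dvd h.ge) (graphLattice_left_dvd h.le)
      have ha0 : a ≠ 0 := (Nat.pos_of_mem_divisors ha).ne'
      obtain rfl : m = m' :=
        Nat.dvd_antisymm (graphLattice_right_dvd ha0 h.ge) (graphLattice_right_dvd ha0 h.le)
      obtain rfl := eq_of_graphLattice_le ha0 h.le
      rfl
    · rintro ⟨L, hswap, hL⟩
      obtain ⟨a, m, ham, u, hu, rfl⟩ := exists_eq_graphLattice hn hswap hL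
      have hm : m ∣ n := (Dvd.intro_left a rfl).trans ham
      have hm0 : m ≠ 0 := ne_zero_of_dvd_ne_zero hn hm
      refine ⟨⟨⟨m, Nat.mem_divisors.2 ⟨hm, hn⟩⟩, ⟨u, hu⟩, ⟨a, Nat.mem_divisors.2 ⟨?_, ?_⟩⟩⟩, rfl⟩
      · exact (Nat.dvd_div_iff_mul_dvd hm).2 (by rwa [mul_comm])
      · exact (Nat.div_pos (Nat.le_of_dvd (Nat.pos_of_ne_zero hn) hm)
          (Nat.pos_of_ne_zero hm0)).ne'
  have hne : ∀ m : n.divisors, NeZero (m : ℕ) := fun m => ⟨(Nat.pos_of_mem_divisors m.2).ne'⟩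
  rw [← Nat.card_congr (Equiv.ofBijective F hF), Nat.card_sigma,
    ArithmeticFunction.mul_apply, Nat.sum_divisorsAntidiagonal (fun a b => sqrtOneCard a * σ 0 b),
    ← Finset.sum_coe_sort n.divisors fun m => sqrtOneCard m * σ 0 (n / m)]
  refine Finset.sum_congr rfl fun m _ => ?_
  rw [Nat.card_prod, sqrtOneCard_apply (hne m).out, ArithmeticFunction.sigma_zero_apply,
    Nat.card_eq_fintype_card (α := (n / (m : ℕ)).divisors), Fintype.card_coe]

/-- The homomorphism `(i, j) ↦ diag(g ^ i, g ^ j)`. -/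
def diagZPow {ℓ : ℕ} (g : (ZMod ℓ)ˣ) : Multiplicative (ℤ × ℤ) →* GL2 ℓ where
  toFun x :=
    { val := !![((g ^ x.toAdd.1 : (ZMod ℓ)ˣ) : ZMod ℓ), 0; 0, ((g ^ x.toAdd.2 : (ZMod ℓ)ˣ) : ZMod ℓ)]
      inv := !![((g ^ (-x.toAdd.1) : (ZMod ℓ)ˣ) : ZMod ℓ), 0;
        0, ((g ^ (-x.toAdd.2) : (ZMod ℓ)ˣ) : ZMod ℓ)]
      val_inv := by
        rw [Matrix.mul_fin_two, Matrix.one_fin_two]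
        simp [← Units.val_mul]
      inv_val := by
        rw [Matrix.mul_fin_two, Matrix.one_fin_two]
        simp [← Units.val_mul] }
  map_one' := by
    ext i j
    fin_cases i <;> fin_cases j <;> simp
  map_mul' x y := by
    ext i j
    fin_cases i <;> fin_cases j <;> simp [_root_.zpow_add]

theorem coe_diagZPow {ℓ : ℕ} (g : (ZMod ℓ)ˣ) (x : Multiplicative (ℤ × ℤ)) :
    ((diagZPow g x : GL2 ℓ) : Matrix (Fin 2) (Fin 2) (ZMod ℓ)) =
      !![((g ^ x.toAdd.1 : (ZMod ℓ)ˣ) : ZMod ℓ), 0; 0, ((g ^ x.toAdd.2 : (ZMod ℓ)ˣ) : ZMod ℓ)] :=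
  rfl

theorem isDiagElt_diagZPow {ℓ : ℕ} (g : (ZMod ℓ)ˣ) (x : Multiplicative (ℤ × ℤ)) :
    IsDiagElt (diagZPow g x) := by
  simp [IsDiagElt, mat, coe_diagZPow]

theorem exists_diagZPow_eq {ℓ : ℕ} {g : (ZMod ℓ)ˣ} (hg : ∀ u, u ∈ Subgroup.zpowers g)
    {c : GL2 ℓ} (hc : IsDiagElt c) : ∃ x, diagZPow g x = c := by
  have hdet : IsUnit ((c : Matrix (Fin 2) (Fin 2) (ZMod ℓ)) 0 0 *
      (c : Matrix (Fin 2) (Fin 2) (ZMod ℓ)) 1 1) := by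
    have h := (Matrix.isUnit_iff_isUnit_det _).1 c.isUnit
    have h0 : (c : Matrix (Fin 2) (Fin 2) (ZMod ℓ)) 0 1 = 0 := hc.1
    rwa [Matrix.det_fin_two, h0, zero_mul, sub_zero] at h
  obtain ⟨a, ha⟩ := isUnit_of_mul_isUnit_left hdet
  obtain ⟨b, hb⟩ := isUnit_of_mul_isUnit_right hdet
  obtain ⟨i, rfl⟩ := hg a
  obtain ⟨j, rfl⟩ := hg b
  refine ⟨Multiplicative.ofAdd (i, j), Units.ext ?_⟩
  rw [coe_diagZPow, Matrix.eta_fin_two (c : Matrix (Fin 2) (Fin 2) (ZMod ℓ)), ← ha, ← hb]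
  exact congrArg₂ (fun y z => !![_, y; z, _]) hc.1.symm hc.2.symm

theorem conj_diagZPow_of_isAntidiagElt {ℓ : ℕ} (g : (ZMod ℓ)ˣ) {c : GL2 ℓ}
    (hc : IsAntidiagElt c) (x : ℤ × ℤ) :
    c * diagZPow g (Multiplicative.ofAdd x) * c⁻¹ =
      diagZPow g (Multiplicative.ofAdd x.swap) := by
  rw [mul_inv_eq_iff_eq_mul]
  refine Units.ext ?_
  have h0 : (c : Matrix (Fin 2) (Fin 2) (ZMod ℓ)) 0 0 = 0 := hc.1
  have h1 : (c : Matrix (Fin 2) (Fin 2) (ZMod ℓ)) 1 1 = 0 := hc.2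
  rw [Units.val_mul, Units.val_mul, coe_diagZPow, coe_diagZPow,
    Matrix.eta_fin_two (c : Matrix (Fin 2) (Fin 2) (ZMod ℓ)), h0, h1, Matrix.mul_fin_two,
    Matrix.mul_fin_two]
  simp [mul_comm]

theorem exists_isAntidiagElt (ℓ : ℕ) : ∃ c : GL2 ℓ, IsAntidiagElt c :=
  ⟨⟨!![0, 1; 1, 0], !![0, 1; 1, 0], by simp [Matrix.one_fin_two],
    by simp [Matrix.one_fin_two]⟩, by simp [IsAntidiagElt, mat]⟩

theorem diagZPow_eq_one_iff {ℓ : ℕ} (g : (ZMod ℓ)ˣ) (x : ℤ × ℤ) :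
    diagZPow g (Multiplicative.ofAdd x) = 1 ↔
      (orderOf g : ℤ) ∣ x.1 ∧ (orderOf g : ℤ) ∣ x.2 := by
  rw [orderOf_dvd_iff_zpow_eq_one, orderOf_dvd_iff_zpow_eq_one, ← Units.val_inj, coe_diagZPow,
    Units.val_one, Matrix.one_fin_two]
  simp

/-- Normal subgroups of `C_s⁺(ℓ)` inside `C_s(ℓ)` correspond to swap-invariant lattices, given a
generator `g` of the unit group. -/
def normalSubgroupEquivSwapLattice {ℓ : ℕ} {g : (ZMod ℓ)ˣ} (hg : ∀ u, u ∈ Subgroup.zpowers g) :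
    {H : Subgroup (GL2 ℓ) //
      (∀ g ∈ H, IsDiagElt g) ∧
      ∀ c : GL2 ℓ, (IsDiagElt c ∨ IsAntidiagElt c) → ∀ h ∈ H, c * h * c⁻¹ ∈ H} ≃
    SwapLattice (orderOf g) where
  toFun H := ⟨AddSubgroup.toSubgroup.symm (H.1.comap (diagZPow g)), by
    obtain ⟨c, hc⟩ := exists_isAntidiagElt ℓ
    refine ⟨fun x hx => ?_, ?_⟩
    · change diagZPow g (Multiplicative.ofAdd x.swap) ∈ H.1
      rw [← conj_diagZPow_of_isAntidiagElt g hc]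
      exact H.2.2 c (Or.inr hc) _ hx
    · change diagZPow g (Multiplicative.ofAdd ((orderOf g : ℤ), (0 : ℤ))) ∈ H.1
      rw [(diagZPow_eq_one_iff g _).2 ⟨dvd_rfl, dvd_zero _⟩]
      exact H.1.one_mem⟩
  invFun L := ⟨(AddSubgroup.toSubgroup L.1).map (diagZPow g), by
    refine ⟨?_, ?_⟩
    · rintro _ ⟨x, -, rfl⟩
      exact isDiagElt_diagZPow g x
    · rintro c (hc | hc) _ ⟨x, hx, rfl⟩
      · obtain ⟨y, rfl⟩ := exists_diagZPow_eq hg hc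
        rw [← map_mul, mul_comm y x, map_mul, mul_inv_cancel_right]
        exact ⟨x, hx, rfl⟩
      · exact ⟨Multiplicative.ofAdd x.toAdd.swap, L.2.1 _ hx,
          (conj_diagZPow_of_isAntidiagElt g hc x.toAdd).symm⟩⟩
  left_inv H := by
    refine Subtype.ext ?_
    change Subgroup.map _ (AddSubgroup.toSubgroup (AddSubgroup.toSubgroup.symm _)) = _
    rw [OrderIso.apply_symm_apply]
    exact Subgroup.map_comap_eq_self fun h hh => exists_diagZPow_eq hg (H.2.1 h hh)
  right_inv L := by
    refine Subtype.ext ?_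
    change AddSubgroup.toSubgroup.symm (Subgroup.comap _ (Subgroup.map _ _)) = L.1
    rw [OrderIso.symm_apply_eq]
    refine Subgroup.comap_map_eq_self fun x hx => ?_
    obtain ⟨⟨i, hi⟩, ⟨j, hj⟩⟩ := (diagZPow_eq_one_iff g x.toAdd).1 hx
    have hmem := L.1.add_mem (L.1.zsmul_mem L.2.2 i) (L.1.zsmul_mem (L.2.1 _ L.2.2) j)
    have heq : x.toAdd = i • ((orderOf g : ℤ), (0 : ℤ)) +
        j • (((orderOf g : ℤ), (0 : ℤ)) : ℤ × ℤ).swap := by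
      ext <;> simp [hi, hj, mul_comm]
    rw [← heq] at hmem
    exact hmem


/-- Let `ℓ` be an odd prime.  The number of subgroups `H` of the split Cartan group
`C_s(ℓ)` that are normal subgroups of its normalizer `C_s⁺(ℓ)` equals `β(ℓ−1)`. -/
theorem stmt5 (ℓ : ℕ) [Fact (Nat.Prime ℓ)] (hodd : Odd ℓ) :
    Nat.card {H : Subgroup (GL2 ℓ) //
      (∀ g ∈ H, IsDiagElt g) ∧
      ∀ c : GL2 ℓ, (IsDiagElt c ∨ IsAntidiagElt c) → ∀ h ∈ H, c * h * c⁻¹ ∈ H} =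
    betaFun (ℓ - 1) := by
  have hℓ : ℓ.Prime := Fact.out
  obtain ⟨g, hg⟩ := IsCyclic.exists_generator (α := (ZMod ℓ)ˣ)
  have hord : orderOf g = ℓ - 1 := by
    rw [orderOf_eq_card_of_forall_mem_zpowers hg, Nat.card_eq_fintype_card, ZMod.card_units]
  have hn : ℓ - 1 ≠ 0 := by
    have := hℓ.two_le
    omega
  rw [Nat.card_congr (normalSubgroupEquivSwapLattice hg), hord, card_swapLattice hn,
    sqrtOneCard_mul_sigma_eq_betaFun hn]
end

section
/- Let ℓ be an odd prime. The number of conjugacy classes of subgroups of GL₂(ℤ/ℓℤ) that are conjugate to a subgroup of the split Cartan group C_s(ℓ) equals (α(ℓ−1) + β(ℓ−1))/2. -/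
open Matrix Pointwise

/-- The lattice in `ℤ × ℤ` spanned by `(a, t)` and `(0, b)`. -/
def spanLattice (a b t : ℕ) : AddSubgroup (ℤ × ℤ) where
  carrier := {p | ∃ k m : ℤ, p.1 = a * k ∧ p.2 = t * k + b * m}
  zero_mem' := ⟨0, 0, by simp, by simp⟩
  add_mem' := by
    rintro p q ⟨k, m, h₁, h₂⟩ ⟨k', m', h₃, h₄⟩
    exact ⟨k + k', m + m', by simp [h₁, h₃]; ring, by simp [h₂, h₄]; ring⟩
  neg_mem' := by
    rintro p ⟨k, m, h₁, h₂⟩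
    exact ⟨-k, -m, by simp [h₁], by simp [h₂]; ring⟩

theorem mem_spanLattice {a b t : ℕ} {x y : ℤ} :
    (x, y) ∈ spanLattice a b t ↔ ∃ k m : ℤ, x = a * k ∧ y = t * k + b * m := Iff.rfl

theorem spanLattice_injective {a b t a' b' t' : ℕ} (ha : 0 < a) (ha' : 0 < a')
    (ht : t < b) (ht' : t' < b') (h : spanLattice a b t = spanLattice a' b' t') :
    a = a' ∧ b = b' ∧ t = t' := by
  have key : ∀ {a b t a' b' t' : ℕ}, 0 < a → 0 < a' →
      spanLattice a b t = spanLattice a' b' t' → a' ∣ a ∧ b' ∣ b := by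
    intro a b t a' b' t' ha ha' h
    have h₁ : ((a : ℤ), (t : ℤ)) ∈ spanLattice a' b' t' :=
      h ▸ mem_spanLattice.2 ⟨1, 0, by simp, by simp⟩
    have h₂ : ((0 : ℤ), (b : ℤ)) ∈ spanLattice a' b' t' :=
      h ▸ mem_spanLattice.2 ⟨0, 1, by simp, by simp⟩
    obtain ⟨k, m, hk, -⟩ := mem_spanLattice.1 h₁
    obtain ⟨k', m', hk', hm'⟩ := mem_spanLattice.1 h₂
    have hk0 : k' = 0 := by
      rcases mul_eq_zero.1 hk'.symm with h0 | h0
      · exact absurd h0 (by positivity)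
      · exact h0
    exact ⟨Int.natCast_dvd_natCast.1 ⟨k, hk⟩,
      Int.natCast_dvd_natCast.1 ⟨m', by simpa [hk0] using hm'⟩⟩
  obtain ⟨h₁, h₂⟩ := key ha ha' h
  obtain ⟨h₃, h₄⟩ := key ha' ha h.symm
  obtain rfl := Nat.dvd_antisymm h₁ h₃
  obtain rfl := Nat.dvd_antisymm h₂ h₄
  refine ⟨rfl, rfl, ?_⟩
  have h₅ : ((a' : ℤ), (t : ℤ)) ∈ spanLattice a' b' t' :=
    h ▸ mem_spanLattice.2 ⟨1, 0, by simp, by simp⟩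
  obtain ⟨k, m, hk, hm⟩ := mem_spanLattice.1 h₅
  have hk1 : k = 1 := by
    have : (a' : ℤ) ≠ 0 := by positivity
    exact mul_left_cancel₀ this (by linarith)
  subst hk1
  have : t ≡ t' [MOD b'] := by
    rw [Nat.modEq_iff_dvd]
    exact ⟨-m, by linarith⟩
  exact this.eq_of_lt_of_lt ht ht'

/-- Membership in the lattice of the multiples of `n`. -/
def ContainsMultiples (n : ℕ) (L : AddSubgroup (ℤ × ℤ)) : Prop :=
  ((n : ℤ), (0 : ℤ)) ∈ L ∧ ((0 : ℤ), (n : ℤ)) ∈ L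

theorem containsMultiples_spanLattice_iff {n a b t : ℕ} (ha : 0 < a) :
    ContainsMultiples n (spanLattice a b t) ↔ a ∣ n ∧ b ∣ n ∧ b ∣ n / a * t := by
  constructor
  · rintro ⟨h₁, h₂⟩
    obtain ⟨k, m, hk, hm⟩ := mem_spanLattice.1 h₁
    obtain ⟨k', m', hk', hm'⟩ := mem_spanLattice.1 h₂
    have hk0 : k' = 0 := by
      rcases mul_eq_zero.1 hk'.symm with h0 | h0
      · exact absurd h0 (by positivity)
      · exact h0
    have han : a ∣ n := Int.natCast_dvd_natCast.1 ⟨k, hk⟩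
    refine ⟨han, Int.natCast_dvd_natCast.1 ⟨m', by simpa [hk0] using hm'⟩, ?_⟩
    obtain ⟨c, rfl⟩ := han
    rw [Nat.mul_div_cancel_left _ ha]
    have hkc : k = c := by
      have : (a : ℤ) ≠ 0 := by positivity
      exact mul_left_cancel₀ this (by rw [← hk]; push_cast; ring)
    subst hkc
    exact Int.natCast_dvd_natCast.1 ⟨-m, by push_cast; linarith⟩
  · rintro ⟨⟨c, rfl⟩, ⟨d, hd⟩, h⟩
    rw [Nat.mul_div_cancel_left _ ha] at h
    obtain ⟨e, he⟩ := h
    refine ⟨mem_spanLattice.2 ⟨c, -e, by push_cast; ring, ?_⟩,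
      mem_spanLattice.2 ⟨0, d, by simp, ?_⟩⟩
    · have : (c : ℤ) * t = b * e := by exact_mod_cast he
      linarith
    · have : ((a * c : ℕ) : ℤ) = b * d := by exact_mod_cast hd
      linarith

theorem exists_eq_spanLattice {n : ℕ} (hn : 0 < n) {L : AddSubgroup (ℤ × ℤ)}
    (hL : ContainsMultiples n L) :
    ∃ a b t : ℕ, 0 < a ∧ t < b ∧ L = spanLattice a b t := by
  obtain ⟨a₀, ha₀⟩ := Int.subgroup_cyclic (L.map (AddMonoidHom.fst ℤ ℤ))
  obtain ⟨b₀, hb₀⟩ := Int.subgroup_cyclic (L.comap (AddMonoidHom.inr ℤ ℤ))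
  have hfst : ∀ x : ℤ, (∃ y, (x, y) ∈ L) ↔ (a₀.natAbs : ℤ) ∣ x := by
    intro x
    rw [Int.natAbs_dvd, ← Int.mem_zmultiples_iff, AddSubgroup.zmultiples_eq_closure, ← ha₀]
    simp
  have hsnd : ∀ y : ℤ, ((0 : ℤ), y) ∈ L ↔ (b₀.natAbs : ℤ) ∣ y := by
    intro x
    rw [Int.natAbs_dvd, ← Int.mem_zmultiples_iff, AddSubgroup.zmultiples_eq_closure, ← hb₀]
    simp
  generalize a₀.natAbs = a at hfst
  generalize b₀.natAbs = b at hsnd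
  have han : a ∣ n := Int.natCast_dvd_natCast.1 ((hfst n).1 ⟨0, hL.1⟩)
  have hbn : b ∣ n := Int.natCast_dvd_natCast.1 ((hsnd n).1 hL.2)
  have ha : 0 < a := Nat.pos_of_dvd_of_pos han hn
  have hb : 0 < b := Nat.pos_of_dvd_of_pos hbn hn
  obtain ⟨u, hu⟩ := (hfst a).2 dvd_rfl
  have hb' : (0 : ℤ) < b := by exact_mod_cast hb
  obtain ⟨t, ht⟩ := Int.eq_ofNat_of_zero_le (Int.emod_nonneg u hb'.ne')
  have htb : t < b := by
    have := Int.emod_lt_of_pos u hb'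
    rw [ht] at this
    exact_mod_cast this
  have htL : ((a : ℤ), (t : ℤ)) ∈ L := by
    have h₁ : ((0 : ℤ), (b : ℤ) * (u / b)) ∈ L := (hsnd _).2 (dvd_mul_right _ _)
    have h₂ := L.sub_mem hu h₁
    have h₃ := Int.emod_add_mul_ediv u b
    rw [ht] at h₃
    simpa [show u - b * (u / b) = t by linarith] using h₂
  refine ⟨a, b, t, ha, htb, ?_⟩
  ext ⟨x, y⟩
  rw [mem_spanLattice]
  constructor
  · intro h
    obtain ⟨k, rfl⟩ := (hfst x).1 ⟨y, h⟩
    have h₁ := L.sub_mem h (L.zsmul_mem htL k)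
    have h₂ : ((0 : ℤ), y - k * t) ∈ L := by simpa [mul_comm] using h₁
    obtain ⟨m, hm⟩ := (hsnd _).1 h₂
    exact ⟨k, m, rfl, by linarith⟩
  · rintro ⟨k, m, rfl, rfl⟩
    have h₁ : ((0 : ℤ), (b : ℤ) * m) ∈ L := (hsnd _).2 (dvd_mul_right _ _)
    have h₂ := L.add_mem (L.zsmul_mem htL k) h₁
    simpa [mul_comm] using h₂

theorem card_filter_dvd_mul {b m : ℕ} (hb : 0 < b) :
    ((Finset.range b).filter (fun t => b ∣ m * t)).card = Nat.gcd b m := by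
  obtain ⟨d, e, hde, hbd, hme⟩ := Nat.exists_coprime b m
  have hg : 0 < Nat.gcd b m := Nat.gcd_pos_of_pos_left m hb
  generalize Nat.gcd b m = g at *
  subst hbd hme
  have hd : 0 < d := Nat.pos_of_mul_pos_right hb
  have himg : (Finset.range (d * g)).filter (fun t => d * g ∣ e * g * t) =
      (Finset.range g).image (d * ·) := by
    ext t
    have hiff : d * g ∣ e * g * t ↔ d ∣ t := by
      rw [mul_right_comm, Nat.mul_dvd_mul_iff_right hg, hde.dvd_mul_left]
    simp only [Finset.mem_filter, Finset.mem_range, Finset.mem_image, hiff]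
    constructor
    · rintro ⟨ht, s, rfl⟩
      exact ⟨s, lt_of_mul_lt_mul_left ht (Nat.zero_le d), rfl⟩
    · rintro ⟨s, hs, rfl⟩
      exact ⟨Nat.mul_lt_mul_of_pos_left hs hd, dvd_mul_right _ _⟩
  rw [himg, Finset.card_image_of_injective _ (fun x y h => Nat.eq_of_mul_eq_mul_left hd h),
    Finset.card_range]

open Finset in
theorem ncard_containsMultiples {n : ℕ} (hn : 0 < n) :
    {L | ContainsMultiples n L}.ncard = alphaFun n := by
  let T : Finset (Σ _ : ℕ × ℕ, ℕ) := (n.divisors ×ˢ n.divisors).sigma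
    fun p => (range p.2).filter (fun t => p.2 ∣ n / p.1 * t)
  have himg : {L | ContainsMultiples n L} =
      (fun x : Σ _ : ℕ × ℕ, ℕ => spanLattice x.1.1 x.1.2 x.2) '' T := by
    ext L
    constructor
    · intro hL
      obtain ⟨a, b, t, ha, ht, rfl⟩ := exists_eq_spanLattice hn hL
      obtain ⟨h₁, h₂, h₃⟩ := (containsMultiples_spanLattice_iff ha).1 hL
      exact ⟨⟨(a, b), t⟩, by simp [T, h₁, h₂, h₃, ht, hn.ne'], rfl⟩
    · rintro ⟨⟨⟨a, b⟩, t⟩, hx, rfl⟩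
      simp only [T, mem_coe, mem_sigma, mem_product, Nat.mem_divisors, mem_filter] at hx
      exact (containsMultiples_spanLattice_iff (Nat.pos_of_dvd_of_pos hx.1.1.1 hn)).2
        ⟨hx.1.1.1, hx.1.2.1, hx.2.2⟩
  have hinj : Set.InjOn (fun x : Σ _ : ℕ × ℕ, ℕ => spanLattice x.1.1 x.1.2 x.2) T := by
    rintro ⟨⟨a, b⟩, t⟩ hx ⟨⟨a', b'⟩, t'⟩ hy h
    simp only [T, mem_coe, mem_sigma, mem_product, Nat.mem_divisors, mem_filter, mem_range] at hx hy
    obtain ⟨rfl, rfl, rfl⟩ := spanLattice_injective (Nat.pos_of_dvd_of_pos hx.1.1.1 hn)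
      (Nat.pos_of_dvd_of_pos hy.1.1.1 hn) hx.2.1 hy.2.1 h
    rfl
  rw [himg, hinj.ncard_image, Set.ncard_coe_finset, card_sigma, sum_product,
    alphaFun, ← Nat.sum_div_divisors n (fun a => ∑ b ∈ n.divisors, Nat.gcd a b)]
  refine sum_congr rfl fun a _ => sum_congr rfl fun b hb => ?_
  rw [card_filter_dvd_mul (Nat.pos_of_mem_divisors hb), Nat.gcd_comm]

theorem finite_containsMultiples {n : ℕ} (hn : 0 < n) : {L | ContainsMultiples n L}.Finite := by
  refine Set.finite_of_ncard_pos ?_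
  have h1 : 1 ∈ n.divisors := Nat.one_mem_divisors.2 hn.ne'
  rw [ncard_containsMultiples hn, alphaFun]
  exact Finset.sum_pos (fun a ha => Finset.sum_pos
    (fun b _ => Nat.gcd_pos_of_pos_left b (Nat.pos_of_mem_divisors ha)) ⟨1, h1⟩) ⟨1, h1⟩

/-- The lattice obtained by exchanging the two coordinates. -/
def swapLattice (L : AddSubgroup (ℤ × ℤ)) : AddSubgroup (ℤ × ℤ) :=
  L.comap (AddEquiv.prodComm : ℤ × ℤ ≃+ ℤ × ℤ).toAddMonoidHom

theorem mem_swapLattice {L : AddSubgroup (ℤ × ℤ)} {x y : ℤ} :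
    (x, y) ∈ swapLattice L ↔ (y, x) ∈ L := Iff.rfl

theorem swapLattice_eq_iff {L : AddSubgroup (ℤ × ℤ)} :
    swapLattice L = L ↔ ∀ x y, (x, y) ∈ L → (y, x) ∈ L := by
  constructor
  · intro h x y hxy
    rw [← h] at hxy
    exact hxy
  · intro h
    ext ⟨x, y⟩
    exact ⟨fun hx => h _ _ hx, fun hx => h _ _ hx⟩

theorem swapLattice_spanLattice_eq_iff {a b t : ℕ} (ha : 0 < a) (ht : t < b) :
    swapLattice (spanLattice a b t) = spanLattice a b t ↔
      ∃ c s : ℕ, b = a * c ∧ t = a * s ∧ s * s ≡ 1 [MOD c] := by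
  have ha' : (a : ℤ) ≠ 0 := by positivity
  rw [swapLattice_eq_iff]
  constructor
  · intro h
    obtain ⟨k, m, hk, hm⟩ := mem_spanLattice.1
      (h 0 b (mem_spanLattice.2 ⟨0, 1, by simp, by simp⟩))
    obtain ⟨k', m', hk', hm'⟩ := mem_spanLattice.1
      (h a t (mem_spanLattice.2 ⟨1, 0, by simp, by simp⟩))
    have hab : a ∣ b := Int.natCast_dvd_natCast.1 ⟨k, hk⟩
    have hat : a ∣ t := Int.natCast_dvd_natCast.1 ⟨k', hk'⟩
    obtain ⟨c, rfl⟩ := hab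
    obtain ⟨s, rfl⟩ := hat
    refine ⟨c, s, rfl, rfl, ?_⟩
    have hs : k' = s := mul_left_cancel₀ ha' (by rw [← hk']; push_cast; ring)
    subst hs
    rw [Nat.modEq_iff_dvd]
    refine ⟨m', mul_left_cancel₀ ha' ?_⟩
    push_cast at hm' ⊢
    linarith
  · rintro ⟨c, s, rfl, rfl, hs⟩ x y h
    obtain ⟨k, m, rfl, rfl⟩ := mem_spanLattice.1 h
    obtain ⟨e, he⟩ := (Nat.modEq_iff_dvd).1 hs
    push_cast at he
    refine mem_spanLattice.2 ⟨s * k + c * m, e * k - s * m, by push_cast; ring, ?_⟩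
    push_cast
    linear_combination (a : ℤ) * k * he

/-- The number of square roots of `1` modulo `c`. -/
def sqrtOneCount : ArithmeticFunction ℕ where
  toFun c := ((Finset.range c).filter (fun s => s * s ≡ 1 [MOD c])).card
  map_zero' := by simp

theorem sqrtOneCount_apply (c : ℕ) :
    sqrtOneCount c = ((Finset.range c).filter (fun s => s * s ≡ 1 [MOD c])).card := rfl

open Finset in
theorem ncard_containsMultiples_swapLattice_eq {n : ℕ} (hn : 0 < n) :
    {L | ContainsMultiples n L ∧ swapLattice L = L}.ncard =
      (ArithmeticFunction.sigma 0 * sqrtOneCount) n := by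
  let f : (Σ _ : ℕ × ℕ, ℕ × ℕ) → AddSubgroup (ℤ × ℤ) :=
    fun x => spanLattice x.2.1 (x.2.1 * x.1.2) (x.2.1 * x.2.2)
  let T : Finset (Σ _ : ℕ × ℕ, ℕ × ℕ) := n.divisorsAntidiagonal.sigma
    fun p => p.1.divisors ×ˢ (range p.2).filter (fun s => s * s ≡ 1 [MOD p.2])
  have hT : ∀ d c a s, (⟨(d, c), (a, s)⟩ : Σ _ : ℕ × ℕ, ℕ × ℕ) ∈ T ↔
      d * c = n ∧ a ∣ d ∧ s < c ∧ s * s ≡ 1 [MOD c] := by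
    intro d c a s
    simp only [T, mem_sigma, mem_product, Nat.mem_divisors, Nat.mem_divisorsAntidiagonal,
      mem_filter, mem_range]
    constructor
    · tauto
    · rintro ⟨h₁, h₂, h₃⟩
      refine ⟨⟨h₁, hn.ne'⟩, ⟨h₂, ?_⟩, h₃⟩
      rintro rfl
      simp at h₁
      omega
  have hpos : ∀ d c a, d * c = n → a ∣ d → 0 < a ∧ 0 < c := by
    intro d c a h₁ h₂
    exact ⟨Nat.pos_of_dvd_of_pos (h₂.trans ⟨c, h₁.symm⟩) hn,
      Nat.pos_of_dvd_of_pos ⟨d, by rw [mul_comm, h₁]⟩ hn⟩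
  have himg : {L | ContainsMultiples n L ∧ swapLattice L = L} = f '' T := by
    ext L
    constructor
    · rintro ⟨hL, hS⟩
      obtain ⟨a, b, t, ha, ht, rfl⟩ := exists_eq_spanLattice hn hL
      obtain ⟨h₁, h₂, h₃⟩ := (containsMultiples_spanLattice_iff ha).1 hL
      obtain ⟨c, s, rfl, rfl, hs⟩ := (swapLattice_spanLattice_eq_iff ha ht).1 hS
      obtain ⟨e, he⟩ := h₂
      exact ⟨⟨(a * e, c), (a, s)⟩, (hT _ _ _ _).2 ⟨by rw [he]; ring, dvd_mul_right _ _,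
        lt_of_mul_lt_mul_left ht (Nat.zero_le a), hs⟩, rfl⟩
    · rintro ⟨⟨⟨d, c⟩, ⟨a, s⟩⟩, hx, rfl⟩
      obtain ⟨h₁, h₂, h₃, h₄⟩ := (hT _ _ _ _).1 hx
      obtain ⟨ha, hc⟩ := hpos d c a h₁ h₂
      refine ⟨(containsMultiples_spanLattice_iff ha).2 ⟨h₂.trans ⟨c, h₁.symm⟩, ?_, ?_⟩,
        (swapLattice_spanLattice_eq_iff ha (Nat.mul_lt_mul_of_pos_left h₃ ha)).2
          ⟨c, s, rfl, rfl, h₄⟩⟩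
      · exact h₁ ▸ Nat.mul_dvd_mul_right h₂ c
      · obtain ⟨e, rfl⟩ := h₂
        rw [← h₁, mul_assoc, Nat.mul_div_cancel_left _ ha]
        exact ⟨e * s, by ring⟩
  have hinj : Set.InjOn f T := by
    rintro ⟨⟨d, c⟩, ⟨a, s⟩⟩ hx ⟨⟨d', c'⟩, ⟨a', s'⟩⟩ hy h
    obtain ⟨h₁, h₂, h₃, -⟩ := (hT _ _ _ _).1 hx
    obtain ⟨h₁', h₂', h₃', -⟩ := (hT _ _ _ _).1 hy
    obtain ⟨ha, hc⟩ := hpos d c a h₁ h₂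
    obtain ⟨ha', hc'⟩ := hpos d' c' a' h₁' h₂'
    obtain ⟨rfl, hb, ht⟩ := spanLattice_injective ha ha'
      (Nat.mul_lt_mul_of_pos_left h₃ ha) (Nat.mul_lt_mul_of_pos_left h₃' ha') h
    obtain rfl := Nat.eq_of_mul_eq_mul_left ha hb
    obtain rfl := Nat.eq_of_mul_eq_mul_left ha ht
    obtain rfl := Nat.eq_of_mul_eq_mul_right hc (h₁.trans h₁'.symm)
    rfl
  rw [himg, hinj.ncard_image, Set.ncard_coe_finset, card_sigma,
    ArithmeticFunction.mul_apply]
  refine sum_congr rfl fun p _ => ?_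
  rw [card_product, sqrtOneCount_apply, ArithmeticFunction.sigma_zero_apply]

theorem sqrtOneCount_eq_card_zmod {c : ℕ} (hc : c ≠ 0) :
    sqrtOneCount c = Nat.card {x : ZMod c // x * x = 1} := by
  have : NeZero c := ⟨hc⟩
  rw [sqrtOneCount_apply, Nat.card_eq_fintype_card, Fintype.card_subtype]
  refine Finset.card_bij' (fun s _ => (s : ZMod c)) (fun x _ => x.val) ?_ ?_ ?_ ?_
  · intro s hs
    simp only [Finset.mem_filter, Finset.mem_univ, true_and] at hs ⊢
    exact_mod_cast (ZMod.natCast_eq_natCast_iff (s * s) 1 c).2 hs.2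
  · intro x hx
    simp only [Finset.mem_filter, Finset.mem_univ, true_and, Finset.mem_range] at hx ⊢
    refine ⟨ZMod.val_lt x, (ZMod.natCast_eq_natCast_iff _ _ c).1 ?_⟩
    simpa using hx
  · intro s hs
    exact ZMod.val_cast_of_lt (Finset.mem_range.1 (Finset.mem_filter.1 hs).1)
  · intro x _
    exact ZMod.natCast_zmod_val x

theorem isMultiplicative_sqrtOneCount : sqrtOneCount.IsMultiplicative := by
  rw [ArithmeticFunction.IsMultiplicative.iff_ne_zero]
  refine ⟨by decide, fun {m n} hm hn hmn => ?_⟩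
  rw [sqrtOneCount_eq_card_zmod hm, sqrtOneCount_eq_card_zmod hn,
    sqrtOneCount_eq_card_zmod (mul_ne_zero hm hn), ← Nat.card_prod]
  let e := ZMod.chineseRemainder hmn
  refine Nat.card_congr ((e.toEquiv.subtypeEquiv
    (q := fun p => p.1 * p.1 = 1 ∧ p.2 * p.2 = 1) fun x => ?_).trans
      (Equiv.subtypeProdEquivProd (p := fun x : ZMod m => x * x = 1)
        (q := fun y : ZMod n => y * y = 1)))
  rw [← e.injective.eq_iff, map_mul, map_one, Prod.ext_iff]
  rfl

theorem sqrtOneCount_prime_pow {p k : ℕ} (hp : p.Prime) (hp2 : p ≠ 2) (hk : k ≠ 0) :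
    sqrtOneCount (p ^ k) = 2 := by
  have hp3 : 3 ≤ p := by have := hp.two_le; omega
  have hq3 : 3 ≤ p ^ k := hp3.trans (Nat.le_self_pow hk p)
  have : (Finset.range (p ^ k)).filter (fun s => s * s ≡ 1 [MOD p ^ k]) = {1, p ^ k - 1} := by
    ext s
    simp only [Finset.mem_filter, Finset.mem_range, Finset.mem_insert, Finset.mem_singleton]
    constructor
    · rintro ⟨hs, h⟩
      have h0 : s ≠ 0 := by
        rintro rfl
        have := (h.eq_of_lt_of_lt (by omega) (by omega))
        omega
      obtain ⟨r, rfl⟩ := Nat.exists_eq_succ_of_ne_zero h0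
      have hd : p ^ k ∣ r * (r + 2) := by
        have := (Nat.modEq_iff_dvd' (by nlinarith)).1 h.symm
        convert this using 1
        rw [Nat.succ_eq_add_one]
        exact Nat.eq_sub_of_add_eq (by ring)
      by_cases hr : p ∣ r
      · left
        have hr2 : ¬ p ∣ r + 2 := fun h2 => by
          have := Nat.le_of_dvd (by norm_num) ((Nat.dvd_add_right hr).1 h2)
          omega
        have hdr : p ^ k ∣ r :=
          (Nat.Coprime.pow_left k ((hp.coprime_iff_not_dvd).2 hr2)).dvd_of_dvd_mul_right hd
        have := Nat.eq_zero_of_dvd_of_lt hdr (by omega)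
        omega
      · right
        have hdr : p ^ k ∣ r + 2 :=
          (Nat.Coprime.pow_left k ((hp.coprime_iff_not_dvd).2 hr)).dvd_of_dvd_mul_left hd
        obtain ⟨c, hc⟩ := hdr
        have : c = 1 := by
          have h1 : c < 2 := by
            by_contra hcon
            have : p ^ k * 2 ≤ p ^ k * c := Nat.mul_le_mul_left _ (by omega)
            omega
          have : c ≠ 0 := by rintro rfl; omega
          omega
        subst this
        omega
    · rintro (rfl | rfl)
      · exact ⟨by omega, rfl⟩
      · refine ⟨by omega, ((Nat.modEq_iff_dvd' ?_).2 ?_).symm⟩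
        · obtain ⟨q, hq⟩ := Nat.exists_eq_add_of_le hq3
          rw [hq]
          have : 3 + q - 1 = q + 2 := by omega
          rw [this]; nlinarith
        · obtain ⟨q, hq⟩ := Nat.exists_eq_add_of_le hq3
          rw [hq]
          have : 3 + q - 1 = q + 2 := by omega
          rw [this]
          exact ⟨q + 1, by rw [Nat.sub_eq_iff_eq_add (by nlinarith)]; ring⟩
  rw [sqrtOneCount_apply, this, Finset.card_pair (by omega)]

theorem sqrtOneCount_two_pow (k : ℕ) : sqrtOneCount (2 ^ (k + 3)) = 4 := by
  obtain ⟨M, hM⟩ : ∃ M, M = 2 ^ (k + 1) := ⟨_, rfl⟩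
  have hM2 : 2 ≤ M := hM ▸ Nat.le_self_pow (by omega) 2
  have h4 : 2 ^ (k + 3) = 4 * M := by rw [hM]; ring
  have : (Finset.range (4 * M)).filter (fun s => s * s ≡ 1 [MOD 4 * M]) =
      {1, 2 * M + 1, 2 * M - 1, 4 * M - 1} := by
    ext s
    simp only [Finset.mem_filter, Finset.mem_range, Finset.mem_insert, Finset.mem_singleton]
    rcases Nat.even_or_odd' s with ⟨u, rfl | rfl⟩
    · refine iff_of_false ?_ (by omega)
      rintro ⟨-, h⟩
      have := h.of_mul_right M
      have h4 : 2 * u * (2 * u) = 4 * (u * u) := by ring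
      rw [h4] at this
      unfold Nat.ModEq at this
      omega
    · have hiff : (2 * u + 1) * (2 * u + 1) ≡ 1 [MOD 4 * M] ↔ M ∣ u * (u + 1) := by
        rw [Nat.ModEq.comm, Nat.modEq_iff_dvd' (by nlinarith)]
        have : (2 * u + 1) * (2 * u + 1) - 1 = 4 * (u * (u + 1)) := by
          rw [Nat.sub_eq_iff_eq_add (by nlinarith)]; ring
        rw [this, Nat.mul_dvd_mul_iff_left (by norm_num)]
      rw [hiff]
      constructor
      · rintro ⟨hs, h⟩
        have hor : M ∣ u ∨ M ∣ u + 1 := by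
          rw [hM] at h ⊢
          rcases Nat.even_or_odd u with hu | hu
          · left
            exact (Nat.Coprime.pow_left _
              (Nat.coprime_two_left.2 hu.add_one)).dvd_of_dvd_mul_right h
          · right
            exact (Nat.Coprime.pow_left _ (Nat.coprime_two_left.2 hu)).dvd_of_dvd_mul_left h
        rcases hor with ⟨c, hc⟩ | ⟨c, hc⟩
        · have : c < 2 := by
            by_contra hcon
            have : M * 2 ≤ M * c := Nat.mul_le_mul_left _ (by omega)
            omega
          interval_cases c <;> omega
        · have : c < 3 := by
            by_contra hcon
            have : M * 3 ≤ M * c := Nat.mul_le_mul_left _ (by omega)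
            omega
          interval_cases c <;> omega
      · intro h
        refine ⟨by omega, ?_⟩
        have : u = 0 ∨ u = M ∨ u + 1 = M ∨ u + 1 = M * 2 := by omega
        rcases this with rfl | rfl | h' | h'
        · simp
        · exact dvd_mul_right _ _
        · rw [h']; exact dvd_mul_left _ _
        · rw [h']; exact ⟨u * 2, by ring⟩
  rw [sqrtOneCount_apply, h4, this]
  rw [Finset.card_insert_of_notMem, Finset.card_insert_of_notMem, Finset.card_pair]
  all_goals try simp only [Finset.mem_insert, Finset.mem_singleton]
  all_goals omega

theorem sigma_mul_prime_pow (f : ArithmeticFunction ℕ) {p : ℕ} (hp : p.Prime) (k : ℕ) :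
    (ArithmeticFunction.sigma 0 * f) (p ^ k) =
      ∑ i ∈ Finset.range (k + 1), (k - i + 1) * f (p ^ i) := by
  rw [mul_comm, ArithmeticFunction.mul_apply, Nat.sum_divisorsAntidiagonal
    (f := fun a b => f a * ArithmeticFunction.sigma 0 b), Nat.sum_divisors_prime_pow hp]
  refine Finset.sum_congr rfl fun i hi => ?_
  have hi' : i ≤ k := by simpa [Nat.lt_succ_iff] using hi
  rw [Nat.pow_div hi' hp.pos, ArithmeticFunction.sigma_zero_apply_prime_pow hp, mul_comm]

theorem sigma_mul_sqrtOneCount_odd {p : ℕ} (hp : p.Prime) (hp2 : p ≠ 2) (k : ℕ) :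
    (ArithmeticFunction.sigma 0 * sqrtOneCount) (p ^ k) = (k + 1) ^ 2 := by
  rw [sigma_mul_prime_pow _ hp, ← Finset.sum_range_reflect]
  have : ∀ j ∈ Finset.range k,
      (k - (k + 1 - 1 - j) + 1) * sqrtOneCount (p ^ (k + 1 - 1 - j)) = (j + 1) * 2 := by
    intro j hj
    have := Finset.mem_range.1 hj
    rw [sqrtOneCount_prime_pow hp hp2 (by omega)]
    congr 2
    omega
  rw [Finset.sum_range_succ, Finset.sum_congr rfl this, ← Finset.sum_mul,
    Finset.sum_add_distrib, add_mul, Finset.sum_range_id_mul_two]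
  have h1 : sqrtOneCount 1 = 1 := by decide
  simp [h1]
  rcases k with _ | k
  · simp
  · simp; ring

theorem sigma_mul_sqrtOneCount_two {k : ℕ} (hk : k ≠ 0) :
    (ArithmeticFunction.sigma 0 * sqrtOneCount) (2 ^ k) = 2 * k ^ 2 - 2 * k + 3 := by
  have h1 : sqrtOneCount (2 ^ 0) = 1 := by decide
  have h2 : sqrtOneCount (2 ^ 1) = 1 := by decide
  have h4 : sqrtOneCount (2 ^ 2) = 2 := by decide
  rw [sigma_mul_prime_pow _ Nat.prime_two]
  rcases k with _ | _ | k
  · exact absurd rfl hk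
  · rw [Finset.sum_range_succ, Finset.sum_range_one, zero_add, h1, h2]
    rfl
  · rw [Finset.sum_range_succ', Finset.sum_range_succ', Finset.sum_range_succ']
    have : ∀ j ∈ Finset.range k,
        (k + 2 - (j + 1 + 1 + 1) + 1) * sqrtOneCount (2 ^ (j + 1 + 1 + 1)) =
          (k - 1 - j + 1) * 4 := by
      intro j hj
      have := Finset.mem_range.1 hj
      rw [sqrtOneCount_two_pow]
      congr 2
      omega
    rw [Finset.sum_congr rfl this, Finset.sum_range_reflect (fun j => (j + 1) * 4),
      ← Finset.sum_mul, Finset.sum_add_distrib]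
    have hg := Finset.sum_range_id_mul_two k
    have h5 : 2 * (k + 1 + 1) ^ 2 - 2 * (k + 1 + 1) + 3 = 2 * k * k + 6 * k + 7 := by
      have : 2 * (k + 1 + 1) ^ 2 = 2 * k * k + 6 * k + 4 + 2 * (k + 1 + 1) := by ring
      omega
    have h6 : k * (k - 1) + k = k * k := by
      rcases k with _ | k
      · simp
      · simp; ring
    rw [h5]
    simp only [zero_add, h1, h2, show (2 : ℕ) ^ (0 + 1 + 1) = 2 ^ 2 from rfl, h4,
      Finset.sum_const, Finset.card_range, smul_eq_mul]
    simp
    nlinarith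

theorem sigma_mul_sqrtOneCount {n : ℕ} (hn : n ≠ 0) :
    (ArithmeticFunction.sigma 0 * sqrtOneCount) n = betaFun n := by
  have hmul : (ArithmeticFunction.sigma 0 * sqrtOneCount).IsMultiplicative :=
    ArithmeticFunction.isMultiplicative_sigma.mul isMultiplicative_sqrtOneCount
  rw [hmul.multiplicative_factorization _ hn, Finsupp.prod, Nat.support_factorization, betaFun]
  have hodd : ∏ p ∈ n.primeFactors.erase 2,
      (ArithmeticFunction.sigma 0 * sqrtOneCount) (p ^ n.factorization p) =
      ∏ p ∈ n.primeFactors.erase 2, (n.factorization p + 1) ^ 2 :=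
    Finset.prod_congr rfl fun p hp => sigma_mul_sqrtOneCount_odd
      (Nat.prime_of_mem_primeFactors (Finset.mem_of_mem_erase hp)) (Finset.ne_of_mem_erase hp) _
  split_ifs with h2
  · have hmem : 2 ∈ n.primeFactors := Nat.mem_primeFactors.2 ⟨Nat.prime_two, h2, hn⟩
    rw [← Finset.mul_prod_erase _ _ hmem, hodd, sigma_mul_sqrtOneCount_two]
    exact (Nat.prime_two.factorization_pos_of_dvd hn h2).ne'
  · have hmem : 2 ∉ n.primeFactors := fun h => h2 (Nat.dvd_of_mem_primeFactors h)
    rw [one_mul, ← hodd, Finset.erase_eq_of_notMem hmem]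

/-- Orbit count for an involution: the classes of the relation `y = x ∨ y = σ x`. -/
theorem two_mul_card_quotient_of_rel_iff {X : Type*} [Finite X] (r : Setoid X) {σ : X → X}
    (hr : ∀ x y, r x y ↔ y = x ∨ y = σ x) :
    2 * Nat.card (Quotient r) = Nat.card X + Nat.card {x // σ x = x} := by
  classical
  have := Fintype.ofFinite X
  have : Fintype (Quotient r) := Fintype.ofFinite _
  have hfib : ∀ q : Quotient r, (Finset.univ.filter fun x : X => Quotient.mk r x = q).card +
      ((Finset.univ.filter fun x : X => σ x = x).filter fun x => Quotient.mk r x = q).card = 2 := by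
    intro q
    induction q using Quotient.inductionOn with
    | h x =>
      have hmk : ∀ y, Quotient.mk r y = Quotient.mk r x ↔ y = x ∨ y = σ x := fun y => by
        rw [eq_comm, Quotient.eq]
        exact hr x y
      have hσσ : σ (σ x) = x ∨ σ (σ x) = σ x := by
        have h₁ : r (σ x) x := r.symm ((hr x (σ x)).2 (Or.inr rfl))
        rcases (hr _ _).1 h₁ with h | h
        · right; rw [← h, ← h]
        · left; exact h.symm
      have h₁ : (Finset.univ.filter fun y : X => Quotient.mk r y = Quotient.mk r x) =
          {x, σ x} := by
        ext y
        simp [hmk]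
      have h₂ : σ (σ x) = σ x → σ x = x := by
        intro h
        have h₁ : r (σ x) x := r.symm ((hr x (σ x)).2 (Or.inr rfl))
        rcases (hr _ _).1 h₁ with h' | h'
        · exact h'.symm
        · rw [h] at h'
          exact h'.symm
      by_cases hx : σ x = x
      · have h₃ : ((Finset.univ.filter fun y : X => σ y = y).filter
            fun y => Quotient.mk r y = Quotient.mk r x) = {x} := by
          ext y
          simp only [Finset.mem_filter, Finset.mem_univ, true_and, Finset.mem_singleton, hmk, hx]
          constructor
          · tauto
          · rintro rfl
            tauto
        rw [h₁, h₃]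
        simp [hx]
      · have h₃ : ((Finset.univ.filter fun y : X => σ y = y).filter
            fun y => Quotient.mk r y = Quotient.mk r x) = ∅ := by
          ext y
          simp only [Finset.mem_filter, Finset.mem_univ, true_and, Finset.notMem_empty, iff_false,
            hmk]
          rintro ⟨hy, rfl | rfl⟩
          · exact hx hy
          · exact hx (h₂ hy)
        rw [h₁, h₃, Finset.card_pair (Ne.symm hx)]
        simp
  rw [Nat.card_eq_fintype_card, Nat.card_eq_fintype_card, Nat.card_eq_fintype_card,
    Fintype.card_subtype, ← Finset.card_univ (α := X),
    Finset.card_eq_sum_card_fiberwise (f := Quotient.mk r) (t := Finset.univ) (by simp),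
    Finset.card_eq_sum_card_fiberwise (s := Finset.univ.filter fun x : X => σ x = x)
      (f := Quotient.mk r) (t := Finset.univ) (by simp),
    ← Finset.sum_add_distrib, Finset.sum_congr rfl fun q _ => hfib q]
  simp [mul_comm]

section Diagonal

variable {ℓ : ℕ}

/-- The diagonal matrix with the given unit entries. -/
def diagElt (u v : (ZMod ℓ)ˣ) : GL2 ℓ where
  val := !![(u : ZMod ℓ), 0; 0, (v : ZMod ℓ)]
  inv := !![((u⁻¹ : (ZMod ℓ)ˣ) : ZMod ℓ), 0; 0, ((v⁻¹ : (ZMod ℓ)ˣ) : ZMod ℓ)]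
  val_inv := by ext i j; fin_cases i <;> fin_cases j <;> simp
  inv_val := by ext i j; fin_cases i <;> fin_cases j <;> simp

/-- The matrix exchanging the two coordinates. -/
def swapElt : GL2 ℓ where
  val := !![0, 1; 1, 0]
  inv := !![0, 1; 1, 0]
  val_inv := by ext i j; fin_cases i <;> fin_cases j <;> simp
  inv_val := by ext i j; fin_cases i <;> fin_cases j <;> simp

theorem coe_diagElt (u v : (ZMod ℓ)ˣ) :
    (diagElt u v : Matrix (Fin 2) (Fin 2) (ZMod ℓ)) = !![(u : ZMod ℓ), 0; 0, (v : ZMod ℓ)] := rfl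

theorem coe_swapElt : ((swapElt : GL2 ℓ) : Matrix (Fin 2) (Fin 2) (ZMod ℓ)) = !![0, 1; 1, 0] := rfl

theorem diagElt_mul (u v u' v' : (ZMod ℓ)ˣ) :
    diagElt u v * diagElt u' v' = diagElt (u * u') (v * v') := by
  ext i j
  fin_cases i <;> fin_cases j <;> simp [coe_diagElt]

theorem isDiagElt_diagElt (u v : (ZMod ℓ)ˣ) : IsDiagElt (diagElt u v) := by
  simp [IsDiagElt, mat, coe_diagElt]

theorem diagElt_injective {u v u' v' : (ZMod ℓ)ˣ} (h : diagElt u v = diagElt u' v') :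
    u = u' ∧ v = v' := by
  have h' : (diagElt u v : Matrix (Fin 2) (Fin 2) (ZMod ℓ)) = diagElt u' v' := by rw [h]
  rw [coe_diagElt, coe_diagElt] at h'
  have h₀ := congrFun (congrFun h' 0) 0
  have h₁ := congrFun (congrFun h' 1) 1
  exact ⟨Units.ext (by simpa using h₀), Units.ext (by simpa using h₁)⟩

theorem IsDiagElt.exists_eq [Fact ℓ.Prime] {x : GL2 ℓ} (hx : IsDiagElt x) :
    ∃ u v, x = diagElt u v := by
  obtain ⟨h₁, h₂⟩ := hx
  have hdet : (x : Matrix (Fin 2) (Fin 2) (ZMod ℓ)).det ≠ 0 := by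
    exact (x.isUnit.map Matrix.detMonoidHom).ne_zero
  simp only [mat] at h₁ h₂
  rw [Matrix.det_fin_two, h₁, zero_mul, sub_zero] at hdet
  refine ⟨Units.mk0 _ (left_ne_zero_of_mul hdet), Units.mk0 _ (right_ne_zero_of_mul hdet), ?_⟩
  ext i j
  fin_cases i <;> fin_cases j <;> simp [coe_diagElt, h₁, h₂]

theorem swapElt_mul_diagElt (u v : (ZMod ℓ)ˣ) :
    swapElt * diagElt u v = diagElt v u * swapElt := by
  ext i j
  fin_cases i <;> fin_cases j <;> simp [coe_diagElt, coe_swapElt]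

/-- An element conjugating a non-scalar diagonal matrix to a diagonal matrix normalises the
diagonal torus, acting on it trivially or by exchanging the entries. -/
theorem conj_diagElt_of_ne [Fact ℓ.Prime] {x : GL2 ℓ} {u v u' v' : (ZMod ℓ)ˣ} (huv : u ≠ v)
    (h : x * diagElt u v = diagElt u' v' * x) :
    (∀ s t, x * diagElt s t * x⁻¹ = diagElt s t) ∨
      (∀ s t, x * diagElt s t * x⁻¹ = diagElt t s) := by
  have hdet : (x : Matrix (Fin 2) (Fin 2) (ZMod ℓ)).det ≠ 0 :=
    (x.isUnit.map Matrix.detMonoidHom).ne_zero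
  rw [Matrix.det_fin_two] at hdet
  have h' : (x : Matrix (Fin 2) (Fin 2) (ZMod ℓ)) * (diagElt u v : Matrix _ _ (ZMod ℓ)) =
    (diagElt u' v' : Matrix _ _ (ZMod ℓ)) * (x : Matrix _ _ (ZMod ℓ)) := congrArg Units.val h
  rw [coe_diagElt, coe_diagElt] at h'
  have huv' : (u : ZMod ℓ) ≠ v := fun h => huv (Units.ext h)
  have h00 := congrFun (congrFun h' 0) 0
  have h01 := congrFun (congrFun h' 0) 1
  have h10 := congrFun (congrFun h' 1) 0
  have h11 := congrFun (congrFun h' 1) 1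
  simp only [Matrix.mul_apply, Fin.sum_univ_two, Matrix.of_apply, Matrix.cons_val',
    Matrix.cons_val_zero, Matrix.cons_val_one, Matrix.cons_val_fin_one, mul_zero, zero_mul,
    add_zero, zero_add] at h00 h01 h10 h11
  by_cases hp : (x : Matrix (Fin 2) (Fin 2) (ZMod ℓ)) 0 0 = 0
  · right
    have hqr : (x : Matrix (Fin 2) (Fin 2) (ZMod ℓ)) 1 0 ≠ 0 := by
      intro h0
      simp [hp, h0] at hdet
    have hv' : (u : ZMod ℓ) = v' := mul_left_cancel₀ hqr (by rw [h10, mul_comm])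
    have hs : (x : Matrix (Fin 2) (Fin 2) (ZMod ℓ)) 1 1 = 0 := by
      rw [← hv'] at h11
      have : (x : Matrix (Fin 2) (Fin 2) (ZMod ℓ)) 1 1 * ((u : ZMod ℓ) - v) = 0 := by
        linear_combination -h11
      exact (mul_eq_zero.1 this).resolve_right (sub_ne_zero.2 huv')
    intro s t
    rw [mul_inv_eq_iff_eq_mul]
    ext i j
    fin_cases i <;> fin_cases j <;> simp [coe_diagElt, Matrix.mul_apply, hp, hs, mul_comm]
  · left
    have hu' : (u : ZMod ℓ) = u' := mul_left_cancel₀ hp (by rw [h00, mul_comm])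
    have hq : (x : Matrix (Fin 2) (Fin 2) (ZMod ℓ)) 0 1 = 0 := by
      rw [← hu'] at h01
      have : (x : Matrix (Fin 2) (Fin 2) (ZMod ℓ)) 0 1 * ((u : ZMod ℓ) - v) = 0 := by
        linear_combination -h01
      exact (mul_eq_zero.1 this).resolve_right (sub_ne_zero.2 huv')
    have hs : (x : Matrix (Fin 2) (Fin 2) (ZMod ℓ)) 1 1 ≠ 0 := by
      intro h0
      simp [hq, h0] at hdet
    have hv' : (v : ZMod ℓ) = v' := mul_left_cancel₀ hs (by rw [h11, mul_comm])
    have hr : (x : Matrix (Fin 2) (Fin 2) (ZMod ℓ)) 1 0 = 0 := by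
      rw [← hv'] at h10
      have : (x : Matrix (Fin 2) (Fin 2) (ZMod ℓ)) 1 0 * ((u : ZMod ℓ) - v) = 0 := by
        linear_combination h10
      exact (mul_eq_zero.1 this).resolve_right (sub_ne_zero.2 huv')
    intro s t
    rw [mul_inv_eq_iff_eq_mul]
    ext i j
    fin_cases i <;> fin_cases j <;> simp [coe_diagElt, Matrix.mul_apply, hq, hr, mul_comm]

theorem conj_diagElt_self (x : GL2 ℓ) (u : (ZMod ℓ)ˣ) :
    x * diagElt u u * x⁻¹ = diagElt u u := by
  rw [mul_inv_eq_iff_eq_mul]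
  ext i j
  fin_cases i <;> fin_cases j <;> simp [coe_diagElt, Matrix.mul_apply, mul_comm]

/-- The homomorphism `(i, j) ↦ diag(gⁱ, gʲ)`. -/
def diagPow (g : (ZMod ℓ)ˣ) : Multiplicative (ℤ × ℤ) →* GL2 ℓ where
  toFun p := diagElt (g ^ p.toAdd.1) (g ^ p.toAdd.2)
  map_one' := by ext i j; fin_cases i <;> fin_cases j <;> simp [coe_diagElt]
  map_mul' p q := by simp [diagElt_mul, _root_.zpow_add]

/-- The group of diagonal matrices `diag(gⁱ, gʲ)` with exponents in a lattice. -/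
def diagSubgroup (g : (ZMod ℓ)ˣ) (L : AddSubgroup (ℤ × ℤ)) : Subgroup (GL2 ℓ) :=
  (AddSubgroup.toSubgroup L).map (diagPow g)

theorem mem_diagSubgroup {g : (ZMod ℓ)ˣ} {L : AddSubgroup (ℤ × ℤ)} {x : GL2 ℓ} :
    x ∈ diagSubgroup g L ↔ ∃ i j : ℤ, (i, j) ∈ L ∧ diagElt (g ^ i) (g ^ j) = x := by
  constructor
  · rintro ⟨p, hp, rfl⟩
    exact ⟨p.toAdd.1, p.toAdd.2, hp, rfl⟩
  · rintro ⟨i, j, hp, rfl⟩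
    exact ⟨Multiplicative.ofAdd (i, j), hp, rfl⟩

theorem ContainsMultiples.mem_of_dvd {n : ℕ} {L : AddSubgroup (ℤ × ℤ)}
    (hL : ContainsMultiples n L) {x y : ℤ} (hx : (n : ℤ) ∣ x) (hy : (n : ℤ) ∣ y) :
    (x, y) ∈ L := by
  obtain ⟨a, rfl⟩ := hx
  obtain ⟨b, rfl⟩ := hy
  simpa [mul_comm] using L.add_mem (L.zsmul_mem hL.1 a) (L.zsmul_mem hL.2 b)

theorem diagElt_mem_diagSubgroup {g : (ZMod ℓ)ˣ} {L : AddSubgroup (ℤ × ℤ)}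
    (hL : ContainsMultiples (orderOf g) L) {i j : ℤ} :
    diagElt (g ^ i) (g ^ j) ∈ diagSubgroup g L ↔ (i, j) ∈ L := by
  rw [mem_diagSubgroup]
  constructor
  · rintro ⟨i', j', h, he⟩
    obtain ⟨h₁, h₂⟩ := diagElt_injective he
    have hd : ∀ {a b : ℤ}, g ^ a = g ^ b → (orderOf g : ℤ) ∣ b - a := fun hab => by
      rw [orderOf_dvd_iff_zpow_eq_one, _root_.zpow_sub, hab, mul_inv_cancel]
    simpa using L.add_mem h (hL.mem_of_dvd (hd h₁) (hd h₂))
  · intro h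
    exact ⟨i, j, h, rfl⟩

theorem diagSubgroup_injective {g : (ZMod ℓ)ˣ} {L L' : AddSubgroup (ℤ × ℤ)}
    (hL : ContainsMultiples (orderOf g) L) (hL' : ContainsMultiples (orderOf g) L')
    (h : diagSubgroup g L = diagSubgroup g L') : L = L' := by
  ext ⟨i, j⟩
  rw [← diagElt_mem_diagSubgroup hL, h, diagElt_mem_diagSubgroup hL']

theorem ContainsMultiples.swapLattice {n : ℕ} {L : AddSubgroup (ℤ × ℤ)}
    (hL : ContainsMultiples n L) : ContainsMultiples n (swapLattice L) :=
  ⟨hL.2, hL.1⟩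

theorem mem_conj_smul {G : Type*} [Group G] {H : Subgroup G} {c : ConjAct G} {x : G} :
    x ∈ c • H ↔ ∃ h ∈ H, ConjAct.ofConjAct c * h * (ConjAct.ofConjAct c)⁻¹ = x := by
  rw [Subgroup.mem_smul_pointwise_iff_exists]
  simp [ConjAct.smul_def]

theorem smul_diagSubgroup_of_fix {g : (ZMod ℓ)ˣ} {L : AddSubgroup (ℤ × ℤ)} {c : ConjAct (GL2 ℓ)}
    (h : ∀ i j, (i, j) ∈ L → ConjAct.ofConjAct c * diagElt (g ^ i) (g ^ j) *
      (ConjAct.ofConjAct c)⁻¹ = diagElt (g ^ i) (g ^ j)) :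
    c • diagSubgroup g L = diagSubgroup g L := by
  ext x
  simp only [mem_conj_smul, mem_diagSubgroup]
  constructor
  · rintro ⟨_, ⟨i, j, hij, rfl⟩, rfl⟩
    exact ⟨i, j, hij, (h i j hij).symm⟩
  · rintro ⟨i, j, hij, rfl⟩
    exact ⟨_, ⟨i, j, hij, rfl⟩, h i j hij⟩

theorem smul_diagSubgroup_of_swap {g : (ZMod ℓ)ˣ} {L : AddSubgroup (ℤ × ℤ)} {c : ConjAct (GL2 ℓ)}
    (h : ∀ u v, ConjAct.ofConjAct c * diagElt u v * (ConjAct.ofConjAct c)⁻¹ = diagElt v u) :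
    c • diagSubgroup g L = diagSubgroup g (swapLattice L) := by
  ext x
  simp only [mem_conj_smul, mem_diagSubgroup, mem_swapLattice]
  constructor
  · rintro ⟨_, ⟨i, j, hij, rfl⟩, rfl⟩
    exact ⟨j, i, hij, (h _ _).symm⟩
  · rintro ⟨i, j, hij, rfl⟩
    exact ⟨_, ⟨j, i, hij, rfl⟩, h _ _⟩

theorem orbitRel_diagSubgroup_iff [Fact ℓ.Prime] {g : (ZMod ℓ)ˣ} {L L' : AddSubgroup (ℤ × ℤ)}
    (hL : ContainsMultiples (orderOf g) L) (hL' : ContainsMultiples (orderOf g) L') :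
    MulAction.orbitRel (ConjAct (GL2 ℓ)) (Subgroup (GL2 ℓ)) (diagSubgroup g L')
      (diagSubgroup g L) ↔ L' = L ∨ L' = swapLattice L := by
  rw [MulAction.orbitRel_apply]
  constructor
  · rintro ⟨c, hc⟩
    replace hc : c • diagSubgroup g L = diagSubgroup g L' := hc
    by_cases hsc : ∀ i j, (i, j) ∈ L → g ^ i = g ^ j
    · left
      rw [smul_diagSubgroup_of_fix fun i j hij => by
        rw [hsc i j hij]; exact conj_diagElt_self _ _] at hc
      exact (diagSubgroup_injective hL hL' hc).symm
    · push Not at hsc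
      obtain ⟨i, j, hij, hne⟩ := hsc
      have hmem : ConjAct.ofConjAct c * diagElt (g ^ i) (g ^ j) * (ConjAct.ofConjAct c)⁻¹ ∈
          diagSubgroup g L' :=
        hc ▸ mem_conj_smul.2 ⟨_, mem_diagSubgroup.2 ⟨i, j, hij, rfl⟩, rfl⟩
      obtain ⟨i', j', -, he⟩ := mem_diagSubgroup.1 hmem
      rcases conj_diagElt_of_ne hne (mul_inv_eq_iff_eq_mul.1 he.symm) with h | h
      · left
        rw [smul_diagSubgroup_of_fix fun i j _ => h _ _] at hc
        exact (diagSubgroup_injective hL hL' hc).symm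
      · right
        rw [smul_diagSubgroup_of_swap h] at hc
        exact (diagSubgroup_injective hL.swapLattice hL' hc).symm
  · rintro (rfl | rfl)
    · exact ⟨1, one_smul _ _⟩
    · exact ⟨ConjAct.toConjAct swapElt, smul_diagSubgroup_of_swap fun u v => by
        rw [mul_inv_eq_iff_eq_mul]; exact swapElt_mul_diagElt u v⟩

theorem exists_eq_diagSubgroup [Fact ℓ.Prime] {g : (ZMod ℓ)ˣ}
    (hg : ∀ u, u ∈ Subgroup.zpowers g) {H : Subgroup (GL2 ℓ)} (hH : ∀ x ∈ H, IsDiagElt x) :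
    ∃ L, ContainsMultiples (orderOf g) L ∧ H = diagSubgroup g L := by
  have key : ∀ i j : ℤ, (i, j) ∈ AddSubgroup.toSubgroup.symm (H.comap (diagPow g)) ↔
      diagElt (g ^ i) (g ^ j) ∈ H := fun i j => Iff.rfl
  refine ⟨AddSubgroup.toSubgroup.symm (H.comap (diagPow g)), ⟨?_, ?_⟩, ?_⟩
  · have h1 : diagElt (g ^ (0 : ℤ)) (g ^ (0 : ℤ)) ∈ H := (H.comap (diagPow g)).one_mem
    rw [key]
    simpa [pow_orderOf_eq_one] using h1
  · have h1 : diagElt (g ^ (0 : ℤ)) (g ^ (0 : ℤ)) ∈ H := (H.comap (diagPow g)).one_mem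
    rw [key]
    simpa [pow_orderOf_eq_one] using h1
  · ext x
    rw [mem_diagSubgroup]
    constructor
    · intro hx
      obtain ⟨u, v, rfl⟩ := (hH x hx).exists_eq
      obtain ⟨i, rfl⟩ := Subgroup.mem_zpowers_iff.1 (hg u)
      obtain ⟨j, rfl⟩ := Subgroup.mem_zpowers_iff.1 (hg v)
      exact ⟨i, j, (key i j).2 hx, rfl⟩
    · rintro ⟨i, j, hij, rfl⟩
      exact (key i j).1 hij

theorem two_mul_conjClassCount [Fact ℓ.Prime] [Finite {L // ContainsMultiples (ℓ - 1) L}] :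
    2 * conjClassCount (fun H : Subgroup (GL2 ℓ) =>
        ∃ c : GL2 ℓ, ∀ x ∈ H, IsDiagElt (c * x * c⁻¹)) =
      {L | ContainsMultiples (ℓ - 1) L}.ncard +
        {L | ContainsMultiples (ℓ - 1) L ∧ swapLattice L = L}.ncard := by
  obtain ⟨g, hg⟩ := IsCyclic.exists_generator (α := (ZMod ℓ)ˣ)
  have hord : orderOf g = ℓ - 1 := by
    rw [orderOf_eq_card_of_forall_mem_zpowers hg, Nat.card_eq_fintype_card, ZMod.card_units]
  let X := {L // ContainsMultiples (ℓ - 1) L}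
  let σ : X → X := fun L => ⟨swapLattice L.1, L.2.swapLattice⟩
  let F : X → {H : Subgroup (GL2 ℓ) // ∃ c : GL2 ℓ, ∀ x ∈ H, IsDiagElt (c * x * c⁻¹)} :=
    fun L => ⟨diagSubgroup g L.1, 1, fun x hx => by
      obtain ⟨i, j, -, rfl⟩ := mem_diagSubgroup.1 hx
      simpa using isDiagElt_diagElt (g ^ i) (g ^ j)⟩
  let s := Setoid.comap (Subtype.val : {H : Subgroup (GL2 ℓ) //
    ∃ c : GL2 ℓ, ∀ x ∈ H, IsDiagElt (c * x * c⁻¹)} → Subgroup (GL2 ℓ))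
    (MulAction.orbitRel (ConjAct (GL2 ℓ)) (Subgroup (GL2 ℓ)))
  have hr : ∀ x y, Setoid.comap F s x y ↔ y = x ∨ y = σ x := fun x y => by
    have hx : ContainsMultiples (orderOf g) x.1 := hord.symm ▸ x.2
    have hy : ContainsMultiples (orderOf g) y.1 := hord.symm ▸ y.2
    rw [Setoid.comm']
    refine (orbitRel_diagSubgroup_iff hx hy).trans ?_
    exact or_congr Subtype.ext_iff.symm (Subtype.ext_iff (a2 := σ x)).symm
  have hcard : Nat.card (Quotient (Setoid.comap F s)) = Nat.card (Quotient s) := by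
    refine Nat.card_congr (Equiv.ofBijective (Quotient.map F fun _ _ h => h) ⟨?_, ?_⟩)
    · intro a b
      induction a, b using Quotient.inductionOn₂ with
      | h a b => exact fun h => Quotient.sound (Quotient.exact (s := s) h)
    · intro q
      induction q using Quotient.inductionOn with
      | h H =>
        obtain ⟨H, c, hc⟩ := H
        obtain ⟨L, hL, he⟩ := exists_eq_diagSubgroup hg (H := ConjAct.toConjAct c • H) (by
          intro x hx
          obtain ⟨y, hy, rfl⟩ := mem_conj_smul.1 hx
          exact hc y hy)
        refine ⟨Quotient.mk _ ⟨L, hord ▸ hL⟩, Quotient.sound ?_⟩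
        exact ⟨ConjAct.toConjAct c, he⟩
  have := two_mul_card_quotient_of_rel_iff _ hr
  rw [hcard] at this
  refine this.trans ?_
  have hfix : Nat.card {x // σ x = x} =
      Nat.card {L // ContainsMultiples (ℓ - 1) L ∧ swapLattice L = L} :=
    Nat.card_congr ((Equiv.subtypeEquivRight fun x => Subtype.ext_iff).trans
      (Equiv.subtypeSubtypeEquivSubtypeInter _ fun L => swapLattice L = L))
  rw [hfix]
  rfl

end Diagonal

/-- Let `ℓ` be an odd prime.  The number of conjugacy classes of subgroups of
`GL₂(ℤ/ℓℤ)` that are conjugate to a subgroup of the split Cartan group `C_s(ℓ)`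
equals `(α(ℓ−1) + β(ℓ−1))/2`. -/
theorem stmt6 (ℓ : ℕ) [Fact (Nat.Prime ℓ)] (hodd : Odd ℓ) :
    conjClassCount (fun H : Subgroup (GL2 ℓ) =>
        ∃ c : GL2 ℓ, ∀ x ∈ H, IsDiagElt (c * x * c⁻¹)) =
      (alphaFun (ℓ - 1) + betaFun (ℓ - 1)) / 2 := by
  have hn : 0 < ℓ - 1 := Nat.sub_pos_of_lt (Fact.out : ℓ.Prime).one_lt
  have : Finite {L // ContainsMultiples (ℓ - 1) L} := (finite_containsMultiples hn).to_subtype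
  have h := two_mul_conjClassCount (ℓ := ℓ)
  rw [ncard_containsMultiples hn, ncard_containsMultiples_swapLattice_eq hn,
    sigma_mul_sqrtOneCount hn.ne'] at h
  omega
end

section
/- Let ℓ be an odd prime and let ε be a non-square in (ℤ/ℓℤ)ˣ. Then distinct subgroups of the non-split Cartan group C_ns(ℓ) are non-conjugate in GL₂(ℤ/ℓℤ), and the number of conjugacy classes of subgroups of GL₂(ℓ) that are conjugate to a subgroup of C_ns(ℓ) equals τ(ℓ² − 1). -/
open Matrix Pointwise

/-- Membership in the non-split Cartan group `C_ns(ℓ)`: matrices of the form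
`[[x, εy],[y, x]]` (with `(x,y) ≠ (0,0)` automatic from invertibility). -/
def IsNSElt {ℓ : ℕ} (ε : ZMod ℓ) (g : GL2 ℓ) : Prop :=
  mat g 1 1 = mat g 0 0 ∧ mat g 0 1 = ε * mat g 1 0

/-- `τ(n)`, the number of positive divisors of `n`. -/
def tauFun (n : ℕ) : ℕ := n.divisors.card

/-- A finite cyclic group has at most one subgroup of each order. -/
theorem IsCyclic.subgroup_eq_of_card_eq {A : Type*} [Group A] [Finite A] [IsCyclic A]
    {H K : Subgroup A} (h : Nat.card H = Nat.card K) : H = K := by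
  classical
  have := Fintype.ofFinite A
  have key (L : Subgroup A) : (L : Set A) = {x : A | x ^ Nat.card L = 1} := by
    have hsub : (L : Set A) ⊆ {x : A | x ^ Nat.card L = 1} := fun x hx =>
      congrArg Subtype.val (pow_card_eq_one' (x := (⟨x, hx⟩ : L)))
    refine Set.eq_of_subset_of_ncard_le hsub ?_ (Set.toFinite _)
    have hle := IsCyclic.card_pow_eq_one_le (α := A) (n := Nat.card L) Nat.card_pos
    rw [← Set.ncard_coe_finset] at hle
    simpa [← Nat.card_coe_set_eq] using hle
  exact SetLike.coe_injective (by rw [key H, key K, h])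

/-- A finite cyclic group has a subgroup of every order dividing the order of the group. -/
theorem IsCyclic.exists_subgroup_card_eq {A : Type*} [Group A] [Finite A] [IsCyclic A]
    {d : ℕ} (hd : d ∣ Nat.card A) : ∃ H : Subgroup A, Nat.card H = d := by
  obtain ⟨g, hg⟩ := IsCyclic.exists_ofOrder_eq_natCard (α := A)
  obtain ⟨e, he⟩ := hd
  have hpos : 0 < Nat.card A := Nat.card_pos
  have he0 : e ≠ 0 := by rintro rfl; omega
  refine ⟨Subgroup.zpowers (g ^ e), ?_⟩
  rw [Nat.card_zpowers, orderOf_pow_of_dvd he0 (hg ▸ Dvd.intro_left d he.symm), hg, he,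
    Nat.mul_div_cancel _ (Nat.pos_of_ne_zero he0)]

section CyclicSubgroup

variable {G : Type*} [Group G] {C : Subgroup G} [Finite C] [IsCyclic C]

theorem Subgroup.eq_of_card_eq_of_le_isCyclic {H K : Subgroup G} (hH : H ≤ C) (hK : K ≤ C)
    (h : Nat.card H = Nat.card K) : H = K := by
  have : H.subgroupOf C = K.subgroupOf C := by
    refine IsCyclic.subgroup_eq_of_card_eq ?_
    rwa [Nat.card_congr (Subgroup.subgroupOfEquivOfLe hH).toEquiv,
      Nat.card_congr (Subgroup.subgroupOfEquivOfLe hK).toEquiv]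
  simpa [Subgroup.subgroupOf_inj, inf_eq_left.2 hH, inf_eq_left.2 hK] using this

theorem Subgroup.card_conjAct_smul (g : ConjAct G) (H : Subgroup G) :
    Nat.card (g • H : Subgroup G) = Nat.card H :=
  Nat.card_congr (Subgroup.equivSMul g H).symm.toEquiv

/-- The number of conjugacy classes of subgroups conjugate into a finite cyclic subgroup `C`
is the number of divisors of the order of `C`. -/
theorem conjClassCount_conj_le_isCyclic :
    conjClassCount (fun H : Subgroup G => ∃ c : G, ∀ x ∈ H, c * x * c⁻¹ ∈ C) =
      (Nat.card C).divisors.card := by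
  have exists_conj (H : Subgroup G) (hH : ∃ c : G, ∀ x ∈ H, c * x * c⁻¹ ∈ C) :
      ∃ g : ConjAct G, g • H ≤ C := by
    obtain ⟨c, hc⟩ := hH
    refine ⟨ConjAct.toConjAct c, fun y hy => ?_⟩
    obtain ⟨x, hx, rfl⟩ := hy
    exact hc x hx
  rw [conjClassCount, ← Fintype.card_coe, ← Nat.card_eq_fintype_card]
  refine Nat.card_congr (Equiv.ofBijective (Quotient.lift (fun H => ⟨Nat.card H.1, ?_⟩) ?_) ⟨?_, ?_⟩)
  · obtain ⟨g, hg⟩ := exists_conj H.1 H.2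
    rw [Nat.mem_divisors, ← Subgroup.card_conjAct_smul g]
    exact ⟨Subgroup.card_dvd_of_le hg, Nat.card_pos.ne'⟩
  · rintro H K ⟨g, hg⟩
    refine Subtype.ext ?_
    change Nat.card H.1 = Nat.card K.1
    rw [← hg]
    exact Subgroup.card_conjAct_smul g K.1
  · rintro ⟨H⟩ ⟨K⟩ h
    have h' : Nat.card H.1 = Nat.card K.1 := congrArg Subtype.val h
    obtain ⟨g, hg⟩ := exists_conj H.1 H.2
    obtain ⟨k, hk⟩ := exists_conj K.1 K.2
    have heq : g • H.1 = k • K.1 := Subgroup.eq_of_card_eq_of_le_isCyclic hg hk (by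
      rw [Subgroup.card_conjAct_smul, Subgroup.card_conjAct_smul, h'])
    refine Quotient.sound ⟨g⁻¹ * k, ?_⟩
    change (g⁻¹ * k) • K.1 = H.1
    rw [mul_smul, ← heq, inv_smul_smul]
  · rintro ⟨d, hd⟩
    obtain ⟨H, hH⟩ := IsCyclic.exists_subgroup_card_eq (Nat.dvd_of_mem_divisors hd)
    refine ⟨Quotient.mk _ ⟨H.map C.subtype, 1, ?_⟩, Subtype.ext ?_⟩
    · rintro _ ⟨y, -, rfl⟩
      simp
    · change Nat.card (H.map C.subtype) = d
      rw [← hH]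
      exact Nat.card_congr (H.equivMapOfInjective _ C.subtype_injective).symm.toEquiv

end CyclicSubgroup

/-- The regular representation of `R[√ε]` on the basis `1, √ε`. -/
def QuadraticAlgebra.regularMatrix {R : Type*} [CommRing R] (ε : R) :
    QuadraticAlgebra R ε 0 →* Matrix (Fin 2) (Fin 2) R where
  toFun z := !![z.re, ε * z.im; z.im, z.re]
  map_one' := by ext i j; fin_cases i <;> fin_cases j <;> simp
  map_mul' z w := by
    ext i j
    fin_cases i <;> fin_cases j <;> simp [Matrix.mul_apply, Fin.sum_univ_two] <;> ring

theorem QuadraticAlgebra.regularMatrix_injective {R : Type*} [CommRing R] (ε : R) :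
    Function.Injective (QuadraticAlgebra.regularMatrix ε) := fun z w h => by
  ext
  · exact congrFun (congrFun h 0) 0
  · exact congrFun (congrFun h 1) 0

/-- The non-split Cartan subgroup, as the image of the units of `(ℤ/ℓℤ)[√ε]`. -/
def nonsplitCartan {ℓ : ℕ} (ε : ZMod ℓ) : Subgroup (GL2 ℓ) :=
  (Units.map (QuadraticAlgebra.regularMatrix ε)).range

section NonsplitCartan

variable {ℓ : ℕ} [Fact (Nat.Prime ℓ)] {ε : ZMod ℓ}

theorem fact_sq_ne_of_not_isSquare (hε : ¬ IsSquare ε) :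
    Fact (∀ r : ZMod ℓ, r ^ 2 ≠ ε + 0 * r) :=
  ⟨fun r hr => hε ⟨r, by rw [← sq, hr]; ring⟩⟩

theorem mem_nonsplitCartan_iff (hε : ¬ IsSquare ε) (g : GL2 ℓ) :
    g ∈ nonsplitCartan ε ↔ IsNSElt ε g := by
  have := fact_sq_ne_of_not_isSquare hε
  constructor
  · rintro ⟨z, rfl⟩
    exact ⟨rfl, rfl⟩
  · rintro ⟨h₁, h₂⟩
    have hmat : QuadraticAlgebra.regularMatrix ε ⟨mat g 0 0, mat g 1 0⟩ = mat g := by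
      ext i j
      fin_cases i <;> fin_cases j <;> simp [QuadraticAlgebra.regularMatrix, h₁, h₂]
    have hz : (⟨mat g 0 0, mat g 1 0⟩ : QuadraticAlgebra (ZMod ℓ) ε 0) ≠ 0 := by
      intro h0
      rw [h0] at hmat
      refine g.ne_zero ?_
      change mat g = 0
      rw [← hmat]
      ext i j
      fin_cases i <;> fin_cases j <;> simp [QuadraticAlgebra.regularMatrix]
    exact ⟨Units.mk0 _ hz, Units.ext hmat⟩

/-- The non-split Cartan subgroup is the unit group of `(ℤ/ℓℤ)[√ε]`. -/
noncomputable def unitsEquivNonsplitCartan (ε : ZMod ℓ) :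
    (QuadraticAlgebra (ZMod ℓ) ε 0)ˣ ≃* nonsplitCartan ε :=
  MonoidHom.ofInjective (Units.map_injective (QuadraticAlgebra.regularMatrix_injective ε))

instance : Finite (QuadraticAlgebra (ZMod ℓ) ε 0) :=
  Finite.of_equiv _ (QuadraticAlgebra.equivProd ε 0).symm

instance : Finite (nonsplitCartan ε) :=
  Finite.of_equiv _ (unitsEquivNonsplitCartan ε).toEquiv

theorem isCyclic_nonsplitCartan (hε : ¬ IsSquare ε) : IsCyclic (nonsplitCartan ε) := by
  have := fact_sq_ne_of_not_isSquare hε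
  exact isCyclic_of_surjective _ (unitsEquivNonsplitCartan ε).surjective

theorem card_nonsplitCartan (hε : ¬ IsSquare ε) : Nat.card (nonsplitCartan ε) = ℓ ^ 2 - 1 := by
  have := fact_sq_ne_of_not_isSquare hε
  rw [← Nat.card_congr (unitsEquivNonsplitCartan ε).toEquiv, Nat.card_units,
    Nat.card_congr (QuadraticAlgebra.equivProd ε 0), Nat.card_prod, Nat.card_zmod, sq]

end NonsplitCartan

/-- Let `ℓ` be an odd prime and `ε` a non-square in `(ℤ/ℓℤ)ˣ`.  Distinct subgroups of the
non-split Cartan group `C_ns(ℓ)` are non-conjugate in `GL₂(ℤ/ℓℤ)`, and the number of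
conjugacy classes of subgroups of `GL₂(ℤ/ℓℤ)` conjugate to a subgroup of `C_ns(ℓ)`
equals `τ(ℓ² − 1)`. -/
theorem stmt7 (ℓ : ℕ) [Fact (Nat.Prime ℓ)] (hodd : Odd ℓ)
    (ε : ZMod ℓ) (hε : ¬ IsSquare ε) :
    (∀ H K : Subgroup (GL2 ℓ), (∀ g ∈ H, IsNSElt ε g) → (∀ g ∈ K, IsNSElt ε g) →
      (∃ c : GL2 ℓ, Subgroup.map (MulAut.conj c).toMonoidHom H = K) → H = K) ∧
    conjClassCount (fun H : Subgroup (GL2 ℓ) =>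
        ∃ c : GL2 ℓ, ∀ x ∈ H, IsNSElt ε (c * x * c⁻¹)) = tauFun (ℓ ^ 2 - 1) := by
  have := isCyclic_nonsplitCartan hε
  simp only [← mem_nonsplitCartan_iff hε]
  refine ⟨?_, ?_⟩
  · rintro H _ hH hK ⟨c, rfl⟩
    refine Subgroup.eq_of_card_eq_of_le_isCyclic hH hK ?_
    exact Nat.card_congr (H.equivMapOfInjective _ (MulAut.conj c).injective).toEquiv
  · rw [conjClassCount_conj_le_isCyclic, card_nonsplitCartan hε, tauFun]
end
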